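/- Let X be a Banach space and Γ : [0,1] → cwk(X) a scalarly measurable multifunction. The following are equivalent: (i) Γ is Birkhoff integrable; (ii) Γ is ℋ-integrable and every ℋ-integrable selection of Γ is Birkhoff integrable; (iii) Γ is ℋ-integrable and every ℋ-integrable selection of Γ is McShane integrable; (iv) Γ is ℋ-integrable and every ℋ-integrable selection of Γ is Pettis integrable; (v) Γ is ℋ-integrable and Γ possesses at least one Pettis integrable selection; (vi) Γ is both Pettis integrable and ℋ-integrable. -/

import Mathlib

open Set Metric MeasureTheory Pointwise
open scoped ENNReal NNReal

namespace GaugePaper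

variable (X : Type*) [NormedAddCommGroup X] [NormedSpace ℝ X]

/-- `A ∈ cwk(X)`: `A` is a nonempty, convex and weakly compact subset of `X`. -/
def IsCWK (A : Set X) : Prop :=
  A.Nonempty ∧ Convex ℝ A ∧ IsCompact (toWeakSpace ℝ X '' A)

variable {X}

/-- The support function `σ(x*, A)`. -/
noncomputable def suppFn (x' : X →L[ℝ] ℝ) (A : Set X) : ℝ := sSup (x' '' A)

/-- `‖A‖ = sup {‖x‖ : x ∈ A}`. -/
noncomputable def setNorm (A : Set X) : ℝ := sSup ((fun x => ‖x‖) '' A)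

/-- A gauge on `[0,1]`: a positive function. -/
def IsGauge (δ : ℝ → ℝ) : Prop := ∀ t ∈ Icc (0:ℝ) 1, 0 < δ t

/-- A tagged partition of `[0,1]` into `n` (possibly degenerate) nonoverlapping closed
subintervals `[pt i, pt (i+1)]`, with tags `tag i ∈ [0,1]`. -/
structure TP (n : ℕ) where
  pt : Fin (n + 1) → ℝ
  tag : Fin n → ℝ
  mono : Monotone pt
  first : pt 0 = 0
  last : pt (Fin.last n) = 1
  tagMem : ∀ i, tag i ∈ Icc (0:ℝ) 1

namespace TP

variable {n : ℕ} (P : TP n)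

/-- The `i`-th subinterval of the partition. -/
def ivl (i : Fin n) : Set ℝ := Icc (P.pt i.castSucc) (P.pt i.succ)

/-- The length `|I_i|` of the `i`-th subinterval. -/
def len (i : Fin n) : ℝ := P.pt i.succ - P.pt i.castSucc

/-- A Perron (Henstock) partition: each tag belongs to its interval. -/
def IsPerron : Prop := ∀ i, P.tag i ∈ P.ivl i

/-- `δ`-fineness: `I_i ⊆ (t_i - δ(t_i), t_i + δ(t_i))`. -/
def IsFine (δ : ℝ → ℝ) : Prop :=
  ∀ i, P.ivl i ⊆ Ioo (P.tag i - δ (P.tag i)) (P.tag i + δ (P.tag i))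

/-- An interior Henstock partition: each tag is in the interior of its interval, except
possibly for intervals containing `0` or `1`, where the tag may also be `0` or `1`. -/
def IsInterior : Prop :=
  ∀ i, P.tag i ∈ Ioo (P.pt i.castSucc) (P.pt i.succ) ∨
    (((0:ℝ) ∈ P.ivl i ∨ (1:ℝ) ∈ P.ivl i) ∧ P.tag i ∈ P.ivl i ∩ ({0, 1} : Set ℝ))

end TP

/-- Riemann sum of a multifunction: `∑ i |I_i| • Γ(t_i)` (Minkowski sums). -/
def mSum {n : ℕ} (P : TP n) (Γ : ℝ → Set X) : Set X :=
  ∑ i : Fin n, P.len i • Γ (P.tag i)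

/-- Riemann sum of a function: `∑ i |I_i| • f(t_i)`. -/
def fSum {n : ℕ} (P : TP n) (f : ℝ → X) : X :=
  ∑ i : Fin n, P.len i • f (P.tag i)

/-! ### Gauge integrals of multifunctions -/

/-- Henstock integrability of a multifunction `Γ : [0,1] → cwk(X)`. -/
def HenstockIntegrable (Γ : ℝ → Set X) : Prop :=
  ∃ I : Set X, IsCWK X I ∧ ∀ ε > 0, ∃ δ : ℝ → ℝ, IsGauge δ ∧
    ∀ (n : ℕ) (P : TP n), P.IsPerron → P.IsFine δ → hausdorffDist I (mSum P Γ) < ε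

/-- McShane integrability of a multifunction (free tags). -/
def McShaneIntegrable (Γ : ℝ → Set X) : Prop :=
  ∃ I : Set X, IsCWK X I ∧ ∀ ε > 0, ∃ δ : ℝ → ℝ, IsGauge δ ∧
    ∀ (n : ℕ) (P : TP n), P.IsFine δ → hausdorffDist I (mSum P Γ) < ε

/-- `ℋ`-integrability: Henstock integrability with Lebesgue measurable gauges. -/
def HMeasIntegrable (Γ : ℝ → Set X) : Prop :=
  ∃ I : Set X, IsCWK X I ∧ ∀ ε > 0, ∃ δ : ℝ → ℝ, IsGauge δ ∧ AEMeasurable δ volume ∧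
    ∀ (n : ℕ) (P : TP n), P.IsPerron → P.IsFine δ → hausdorffDist I (mSum P Γ) < ε

/-- Birkhoff (`ℳ`-) integrability: McShane integrability with Lebesgue measurable gauges. -/
def BirkhoffIntegrable (Γ : ℝ → Set X) : Prop :=
  ∃ I : Set X, IsCWK X I ∧ ∀ ε > 0, ∃ δ : ℝ → ℝ, IsGauge δ ∧ AEMeasurable δ volume ∧
    ∀ (n : ℕ) (P : TP n), P.IsFine δ → hausdorffDist I (mSum P Γ) < ε

/-! ### Gauge integrals of (single-valued) functions -/

/-- Henstock integrability of a function `f : [0,1] → X`. -/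
def FHenstockIntegrable (f : ℝ → X) : Prop :=
  ∃ w : X, ∀ ε > 0, ∃ δ : ℝ → ℝ, IsGauge δ ∧
    ∀ (n : ℕ) (P : TP n), P.IsPerron → P.IsFine δ → ‖w - fSum P f‖ < ε

/-- McShane integrability of a function. -/
def FMcShaneIntegrable (f : ℝ → X) : Prop :=
  ∃ w : X, ∀ ε > 0, ∃ δ : ℝ → ℝ, IsGauge δ ∧
    ∀ (n : ℕ) (P : TP n), P.IsFine δ → ‖w - fSum P f‖ < ε

/-- `ℋ`-integrability of a function: measurable gauges. -/
def FHMeasIntegrable (f : ℝ → X) : Prop :=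
  ∃ w : X, ∀ ε > 0, ∃ δ : ℝ → ℝ, IsGauge δ ∧ AEMeasurable δ volume ∧
    ∀ (n : ℕ) (P : TP n), P.IsPerron → P.IsFine δ → ‖w - fSum P f‖ < ε

/-- Birkhoff (`ℳ`-) integrability of a function: McShane with measurable gauges. -/
def FBirkhoffIntegrable (f : ℝ → X) : Prop :=
  ∃ w : X, ∀ ε > 0, ∃ δ : ℝ → ℝ, IsGauge δ ∧ AEMeasurable δ volume ∧
    ∀ (n : ℕ) (P : TP n), P.IsFine δ → ‖w - fSum P f‖ < ε

/-- Henstock–Kurzweil integrability of a real-valued function on `[0,1]`. -/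
def HKIntegrable (g : ℝ → ℝ) : Prop :=
  ∃ A : ℝ, ∀ ε > 0, ∃ δ : ℝ → ℝ, IsGauge δ ∧
    ∀ (n : ℕ) (P : TP n), P.IsPerron → P.IsFine δ → |fSum P g - A| < ε

/-! ### Pettis integrals -/

/-- Pettis integrability of a function `f : [0,1] → X`. -/
def FPettisIntegrable (f : ℝ → X) : Prop :=
  (∀ x' : X →L[ℝ] ℝ, IntegrableOn (fun t => x' (f t)) (Icc (0:ℝ) 1) volume) ∧
  ∀ E ⊆ Icc (0:ℝ) 1, NullMeasurableSet E volume →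
    ∃ ν : X, ∀ x' : X →L[ℝ] ℝ, x' ν = ∫ t in E, x' (f t)

/-- Pettis integrability of a multifunction `Γ : [0,1] → cwk(X)`. -/
def PettisIntegrable (Γ : ℝ → Set X) : Prop :=
  (∀ x' : X →L[ℝ] ℝ, IntegrableOn (fun t => suppFn x' (Γ t)) (Icc (0:ℝ) 1) volume) ∧
  ∀ E ⊆ Icc (0:ℝ) 1, NullMeasurableSet E volume →
    ∃ W : Set X, IsCWK X W ∧ ∀ x' : X →L[ℝ] ℝ, suppFn x' W = ∫ t in E, suppFn x' (Γ t)

/-- `f` is a selection of `Γ`. -/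
def Selection (Γ : ℝ → Set X) (f : ℝ → X) : Prop := ∀ t ∈ Icc (0:ℝ) 1, f t ∈ Γ t

/-! ### Variational integrals -/

/-- Finite additivity of an interval multifunction on subintervals of `[0,1]`
(an interval `[a,b] ⊆ [0,1]` is encoded by its endpoints). -/
def AdditiveIntervalMF (Φ : ℝ → ℝ → Set X) : Prop :=
  ∀ a b c : ℝ, 0 ≤ a → a ≤ b → b ≤ c → c ≤ 1 → Φ a c = Φ a b + Φ b c

/-- Finite additivity of a vector-valued interval function on subintervals of `[0,1]`. -/
def AdditiveIntervalF (Φ : ℝ → ℝ → X) : Prop :=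
  ∀ a b c : ℝ, 0 ≤ a → a ≤ b → b ≤ c → c ≤ 1 → Φ a c = Φ a b + Φ b c

/-- `Φ` is a variational Henstock primitive of the multifunction `Γ`. -/
def vHPrimitive (Γ : ℝ → Set X) (Φ : ℝ → ℝ → Set X) : Prop :=
  (∀ a b : ℝ, 0 ≤ a → a ≤ b → b ≤ 1 → IsCWK X (Φ a b)) ∧ AdditiveIntervalMF Φ ∧
  ∀ ε > 0, ∃ δ : ℝ → ℝ, IsGauge δ ∧ ∀ (n : ℕ) (P : TP n), P.IsPerron → P.IsFine δ →
    ∑ i : Fin n, hausdorffDist (Φ (P.pt i.castSucc) (P.pt i.succ)) (P.len i • Γ (P.tag i)) < ε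

/-- Variational Henstock integrability of a multifunction. -/
def vHIntegrable (Γ : ℝ → Set X) : Prop := ∃ Φ : ℝ → ℝ → Set X, vHPrimitive Γ Φ

/-- Variational McShane integrability of a multifunction (free tags). -/
def vMSIntegrable (Γ : ℝ → Set X) : Prop :=
  ∃ Φ : ℝ → ℝ → Set X,
    (∀ a b : ℝ, 0 ≤ a → a ≤ b → b ≤ 1 → IsCWK X (Φ a b)) ∧ AdditiveIntervalMF Φ ∧
    ∀ ε > 0, ∃ δ : ℝ → ℝ, IsGauge δ ∧ ∀ (n : ℕ) (P : TP n), P.IsFine δ →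
      ∑ i : Fin n, hausdorffDist (Φ (P.pt i.castSucc) (P.pt i.succ)) (P.len i • Γ (P.tag i)) < ε

/-- Variational `ℋ`-integrability of a multifunction: measurable gauges. -/
def vHMeasIntegrable (Γ : ℝ → Set X) : Prop :=
  ∃ Φ : ℝ → ℝ → Set X,
    (∀ a b : ℝ, 0 ≤ a → a ≤ b → b ≤ 1 → IsCWK X (Φ a b)) ∧ AdditiveIntervalMF Φ ∧
    ∀ ε > 0, ∃ δ : ℝ → ℝ, IsGauge δ ∧ AEMeasurable δ volume ∧
      ∀ (n : ℕ) (P : TP n), P.IsPerron → P.IsFine δ →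
        ∑ i : Fin n, hausdorffDist (Φ (P.pt i.castSucc) (P.pt i.succ)) (P.len i • Γ (P.tag i)) < ε

/-- `Φ` is a variational Henstock primitive of the function `f`. -/
def FvHPrimitive (f : ℝ → X) (Φ : ℝ → ℝ → X) : Prop :=
  AdditiveIntervalF Φ ∧
  ∀ ε > 0, ∃ δ : ℝ → ℝ, IsGauge δ ∧ ∀ (n : ℕ) (P : TP n), P.IsPerron → P.IsFine δ →
    ∑ i : Fin n, ‖Φ (P.pt i.castSucc) (P.pt i.succ) - P.len i • f (P.tag i)‖ < ε

/-- Variational Henstock integrability of a function. -/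
def FvHIntegrable (f : ℝ → X) : Prop := ∃ Φ : ℝ → ℝ → X, FvHPrimitive f Φ

/-- Variational McShane integrability of a function (free tags). -/
def FvMSIntegrable (f : ℝ → X) : Prop :=
  ∃ Φ : ℝ → ℝ → X, AdditiveIntervalF Φ ∧
    ∀ ε > 0, ∃ δ : ℝ → ℝ, IsGauge δ ∧ ∀ (n : ℕ) (P : TP n), P.IsFine δ →
      ∑ i : Fin n, ‖Φ (P.pt i.castSucc) (P.pt i.succ) - P.len i • f (P.tag i)‖ < ε

/-- Variational `ℋ`-integrability of a function: measurable gauges. -/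
def FvHMeasIntegrable (f : ℝ → X) : Prop :=
  ∃ Φ : ℝ → ℝ → X, AdditiveIntervalF Φ ∧
    ∀ ε > 0, ∃ δ : ℝ → ℝ, IsGauge δ ∧ AEMeasurable δ volume ∧
      ∀ (n : ℕ) (P : TP n), P.IsPerron → P.IsFine δ →
        ∑ i : Fin n, ‖Φ (P.pt i.castSucc) (P.pt i.succ) - P.len i • f (P.tag i)‖ < ε

/-! ### Partial Perron partitions and variational measures -/

/-- A finite tagged Perron family of `n` nonoverlapping closed subintervals
`[a i, b i]` of `[0,1]` (a "partition in `[0,1]`", not necessarily covering it). -/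
structure PTP (n : ℕ) where
  a : Fin n → ℝ
  b : Fin n → ℝ
  tag : Fin n → ℝ
  le : ∀ i, a i ≤ b i
  sub : ∀ i, Icc (a i) (b i) ⊆ Icc (0:ℝ) 1
  nonoverlap : ∀ i j, i ≠ j → (Icc (a i) (b i) ∩ Icc (a j) (b j)).Subsingleton
  perron : ∀ i, tag i ∈ Icc (a i) (b i)

/-- `δ`-fineness of a partial Perron family. -/
def PTP.IsFine {n : ℕ} (P : PTP n) (δ : ℝ → ℝ) : Prop :=
  ∀ i, Icc (P.a i) (P.b i) ⊆ Ioo (P.tag i - δ (P.tag i)) (P.tag i + δ (P.tag i))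

/-- `Var(Ψ, δ, E)` for a scalar interval function `Ψ`. -/
noncomputable def scVar (Ψ : ℝ → ℝ → ℝ) (δ : ℝ → ℝ) (E : Set ℝ) : ℝ≥0∞ :=
  ⨆ (n : ℕ) (P : PTP n) (_ : P.IsFine δ ∧ ∀ i, P.tag i ∈ E),
    ∑ i : Fin n, ENNReal.ofReal |Ψ (P.a i) (P.b i)|

/-- The variational measure `V_Ψ(E)` generated by a scalar interval function `Ψ`. -/
noncomputable def scVarMeasure (Ψ : ℝ → ℝ → ℝ) (E : Set ℝ) : ℝ≥0∞ :=
  ⨅ (δ : ℝ → ℝ) (_ : IsGauge δ), scVar Ψ δ E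

/-! ### Chains of tagged intervals -/

/-- `TaggedChain A a b l`: the list `l` of tagged intervals `(c, d, t)`, each satisfying `A c d t`,
runs from `a` to `b`. -/
inductive TaggedChain (A : ℝ → ℝ → ℝ → Prop) : ℝ → ℝ → List (ℝ × ℝ × ℝ) → Prop
  | nil (a : ℝ) : TaggedChain A a a []
  | cons {a b c t : ℝ} {l : List (ℝ × ℝ × ℝ)} (hab : a ≤ b) (h : A a b t)
      (hl : TaggedChain A b c l) : TaggedChain A a c ((a, b, t) :: l)

theorem TaggedChain.append {A : ℝ → ℝ → ℝ → Prop} {a b c : ℝ} {l l' : List (ℝ × ℝ × ℝ)}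
    (h : TaggedChain A a b l) (h' : TaggedChain A b c l') : TaggedChain A a c (l ++ l') := by
  induction h with
  | nil => simpa using h'
  | cons hab hA _ ih => exact .cons hab hA (ih h')

theorem TaggedChain.single {A : ℝ → ℝ → ℝ → Prop} {a b t : ℝ} (hab : a ≤ b) (h : A a b t) :
    TaggedChain A a b [(a, b, t)] := .cons hab h (.nil b)

/-- The Riemann sum of a real function along a list of tagged intervals. -/
def listSum (l : List (ℝ × ℝ × ℝ)) (h : ℝ → ℝ) : ℝ :=
  (l.map fun p => (p.2.1 - p.1) * h p.2.2).sum

theorem listSum_append (l l' : List (ℝ × ℝ × ℝ)) (h : ℝ → ℝ) :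
    listSum (l ++ l') h = listSum l h + listSum l' h := by
  simp [listSum]

theorem TaggedChain.exists_fin {A : ℝ → ℝ → ℝ → Prop} {a b : ℝ} {l : List (ℝ × ℝ × ℝ)}
    (h : TaggedChain A a b l) :
    ∃ (n : ℕ) (pt : Fin (n + 1) → ℝ) (tag : Fin n → ℝ), Monotone pt ∧ pt 0 = a ∧
      pt (Fin.last n) = b ∧ (∀ i, A (pt i.castSucc) (pt i.succ) (tag i)) ∧
      ∀ h : ℝ → ℝ, ∑ i : Fin n, (pt i.succ - pt i.castSucc) * h (tag i) = listSum l h := by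
  induction h with
  | nil a => exact ⟨0, fun _ => a, Fin.elim0, fun _ _ _ => le_rfl, rfl, rfl, fun i => i.elim0,
      fun h => by simp [listSum]⟩
  | @cons a b c t l hab hA _ ih =>
    obtain ⟨n, pt, tag, hmono, h0, hlast, hAll, hsum⟩ := ih
    refine ⟨n + 1, Fin.cons a pt, Fin.cons t tag, ?_, rfl, ?_, ?_, ?_⟩
    · rw [Fin.monotone_iff_le_succ]
      intro i
      refine Fin.cases ?_ (fun j => ?_) i
      · simpa [h0] using hab
      · simpa [← Fin.succ_castSucc] using hmono (Fin.castSucc_le_succ j)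
    · rw [← Fin.succ_last, Fin.cons_succ, hlast]
    · intro i
      refine Fin.cases ?_ (fun j => ?_) i
      · simpa [h0] using hA
      · simpa [← Fin.succ_castSucc] using hAll j
    · intro h
      rw [Fin.sum_univ_succ]
      have := hsum h
      simp only [listSum, List.map_cons, List.sum_cons] at this ⊢
      rw [← this]
      simp [h0]

/-- A tagged interval that belongs to a `δ`-fine Perron partition. -/
def FinePerron (δ : ℝ → ℝ) (a b t : ℝ) : Prop :=
  t ∈ Icc a b ∧ t ∈ Icc (0:ℝ) 1 ∧ Icc a b ⊆ Ioo (t - δ t) (t + δ t)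

theorem TaggedChain.exists_TP {δ : ℝ → ℝ} {l : List (ℝ × ℝ × ℝ)}
    (h : TaggedChain (FinePerron δ) 0 1 l) :
    ∃ (n : ℕ) (P : TP n), P.IsPerron ∧ P.IsFine δ ∧ ∀ h : ℝ → ℝ, fSum P h = listSum l h := by
  obtain ⟨n, pt, tag, hmono, h0, hlast, hA, hsum⟩ := h.exists_fin
  exact ⟨n, ⟨pt, tag, hmono, h0, hlast, fun i => (hA i).2.1⟩, fun i => (hA i).1,
    fun i => (hA i).2.2, hsum⟩

/-- Cousin's lemma. -/
theorem exists_taggedChain {δ : ℝ → ℝ} (hδ : IsGauge δ) {a b : ℝ} (ha : 0 ≤ a) (hab : a ≤ b)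
    (hb : b ≤ 1) : ∃ l, TaggedChain (FinePerron δ) a b l := by
  set S : Set ℝ := {x | x ∈ Icc a b ∧ ∃ l, TaggedChain (FinePerron δ) a x l} with hS
  have haS : a ∈ S := ⟨⟨le_rfl, hab⟩, [], .nil a⟩
  have hbdd : BddAbove S := ⟨b, fun x hx => hx.1.2⟩
  set c := sSup S with hc
  have hac : a ≤ c := le_csSup hbdd haS
  have hcb : c ≤ b := csSup_le ⟨a, haS⟩ fun x hx => hx.1.2
  have hcI : c ∈ Icc (0:ℝ) 1 := ⟨ha.trans hac, hcb.trans hb⟩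
  have hδc := hδ c hcI
  obtain ⟨x, hxS, hx⟩ := exists_lt_of_lt_csSup ⟨a, haS⟩ (show c - δ c < sSup S by linarith)
  have hxc : x ≤ c := le_csSup hbdd hxS
  obtain ⟨⟨hax, hxb⟩, l, hl⟩ := hxS
  have key : ∀ y, c ≤ y → y < c + δ c → TaggedChain (FinePerron δ) a y (l ++ [(x, y, c)]) :=
    fun y hcy hy => hl.append (.single (hxc.trans hcy) ⟨⟨hxc, hcy⟩, hcI, fun z hz =>
      ⟨by linarith [hz.1], by linarith [hz.2]⟩⟩)
  rcases hcb.eq_or_lt with h | h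
  · exact ⟨_, h ▸ key c le_rfl (by linarith)⟩
  · exfalso
    have h1 : min b (c + δ c / 2) ∈ S := ⟨⟨hac.trans (le_min hcb (by linarith)), min_le_left _ _⟩,
      _, key _ (le_min hcb (by linarith)) ((min_le_right _ _).trans_lt (by linarith))⟩
    have h2 := le_csSup hbdd h1
    rw [← hc] at h2
    rcases min_le_iff.1 h2 with h3 | h3 <;> linarith

theorem exists_fine_perron {δ : ℝ → ℝ} (hδ : IsGauge δ) :
    ∃ (n : ℕ) (P : TP n), P.IsPerron ∧ P.IsFine δ := by
  obtain ⟨l, hl⟩ := exists_taggedChain hδ le_rfl zero_le_one le_rfl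
  obtain ⟨n, P, h1, h2, _⟩ := hl.exists_TP
  exact ⟨n, P, h1, h2⟩

theorem IsGauge.min {δ δ' : ℝ → ℝ} (h : IsGauge δ) (h' : IsGauge δ') :
    IsGauge fun t => min (δ t) (δ' t) := fun t ht => lt_min (h t ht) (h' t ht)

/-! ### Elementary facts on tagged partitions -/

namespace TP

variable {n : ℕ} (P : TP n)

theorem IsFine.mono {P : TP n} {δ δ' : ℝ → ℝ} (h : P.IsFine δ) (hle : ∀ t, δ t ≤ δ' t) :
    P.IsFine δ' := fun i => (h i).trans (Ioo_subset_Ioo (by linarith [hle (P.tag i)])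
      (by linarith [hle (P.tag i)]))

theorem pt_mem (i : Fin (n + 1)) : P.pt i ∈ Icc (0:ℝ) 1 :=
  ⟨P.first ▸ P.mono (Fin.zero_le i), P.last ▸ P.mono (Fin.le_last i)⟩

theorem pt_le (i : Fin n) : P.pt i.castSucc ≤ P.pt i.succ := P.mono (Fin.castSucc_le_succ i)

theorem len_nonneg (i : Fin n) : 0 ≤ P.len i := sub_nonneg.2 (P.pt_le i)

theorem ivl_subset (i : Fin n) : P.ivl i ⊆ Icc (0:ℝ) 1 :=
  Icc_subset_Icc (P.pt_mem _).1 (P.pt_mem _).2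

theorem Ioc_subset_ivl (i : Fin n) : Ioc (P.pt i.castSucc) (P.pt i.succ) ⊆ P.ivl i :=
  Ioc_subset_Icc_self

theorem pairwise_disjoint :
    Pairwise (Function.onFun Disjoint fun i : Fin n => Ioc (P.pt i.castSucc) (P.pt i.succ)) := by
  intro i j hij
  wlog h : i < j generalizing i j
  · exact (this hij.symm (lt_of_le_of_ne (not_lt.1 h) hij.symm)).symm
  refine Set.disjoint_left.2 fun x hx hx' => ?_
  have : P.pt i.succ ≤ P.pt j.castSucc := P.mono (by simpa [Fin.le_def] using h)
  linarith [hx.2, hx'.1]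

theorem iUnion_Ioc : ⋃ i : Fin n, Ioc (P.pt i.castSucc) (P.pt i.succ) = Ioc (0:ℝ) 1 := by
  ext x
  simp only [mem_iUnion]
  constructor
  · rintro ⟨i, hi⟩
    exact ⟨(P.pt_mem _).1.trans_lt hi.1, hi.2.trans (P.pt_mem _).2⟩
  · intro hx
    by_contra! hcon
    have : ∀ i : Fin (n + 1), P.pt i < x := by
      intro i
      induction i using Fin.induction with
      | zero => rw [P.first]; exact hx.1
      | succ i ih => by_contra h; exact hcon i ⟨ih, not_lt.1 h⟩
    have := this (Fin.last n)
    rw [P.last] at this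
    exact absurd hx.2 (not_le.2 this)

theorem sum_setIntegral {h : ℝ → ℝ} (hh : IntegrableOn h (Icc (0:ℝ) 1)) :
    ∑ i : Fin n, ∫ x in Ioc (P.pt i.castSucc) (P.pt i.succ), h x = ∫ x in Icc (0:ℝ) 1, h x := by
  rw [integral_Icc_eq_integral_Ioc, ← P.iUnion_Ioc,
    integral_iUnion_fintype (fun _ => measurableSet_Ioc) P.pairwise_disjoint]
  exact fun i => hh.mono_set ((P.Ioc_subset_ivl i).trans (P.ivl_subset i))

theorem setIntegral_const (i : Fin n) (c : ℝ) :
    ∫ _ in Ioc (P.pt i.castSucc) (P.pt i.succ), c = P.len i * c := by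
  rw [MeasureTheory.setIntegral_const, smul_eq_mul, measureReal_def, Real.volume_Ioc,
    ENNReal.toReal_ofReal (sub_nonneg.2 (P.pt_le i)), len]

end TP

theorem fSum_real {n : ℕ} (P : TP n) (h : ℝ → ℝ) :
    fSum P h = ∑ i : Fin n, P.len i * h (P.tag i) := rfl

theorem fSum_mono {n : ℕ} (P : TP n) {h h' : ℝ → ℝ} (hh : ∀ t ∈ Icc (0:ℝ) 1, h t ≤ h' t) :
    fSum P h ≤ fSum P h' :=
  Finset.sum_le_sum fun i _ => mul_le_mul_of_nonneg_left (hh _ (P.tagMem i)) (P.len_nonneg i)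

theorem fSum_sub {n : ℕ} (P : TP n) (h h' : ℝ → ℝ) :
    fSum P (fun t => h t - h' t) = fSum P h - fSum P h' := by
  simp [fSum_real, mul_sub, Finset.sum_sub_distrib]

theorem fSum_neg {n : ℕ} (P : TP n) (h : ℝ → ℝ) :
    fSum P (fun t => - h t) = - fSum P h := by
  simp [fSum_real]

/-! ### Lebesgue integrable real functions and Riemann sums -/

theorem exists_gauge_fSum_le {h : ℝ → ℝ} (hh : IntegrableOn h (Icc (0:ℝ) 1)) {ε : ℝ}
    (hε : 0 < ε) : ∃ δ : ℝ → ℝ, IsGauge δ ∧ ∀ (n : ℕ) (P : TP n), P.IsFine δ →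
      fSum P h ≤ (∫ t in Icc (0:ℝ) 1, h t) + ε := by
  obtain ⟨u, hu, hlsc, hint, hfin, hlt⟩ := exists_lt_lowerSemicontinuous_integral_lt
    (μ := volume.restrict (Icc (0:ℝ) 1)) h hh hε
  have hex : ∀ t : ℝ, ∃ d > 0, ∀ x ∈ Ioo (t - d) (t + d), (h t : EReal) < u x := by
    intro t
    obtain ⟨d, hd, hd'⟩ := Metric.eventually_nhds_iff_ball.1 (hlsc t _ (hu t))
    exact ⟨d, hd, fun x hx => hd' x (by rwa [Real.ball_eq_Ioo])⟩
  choose δ hδ hδ' using hex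
  refine ⟨δ, fun t _ => hδ t, fun n P hP => ?_⟩
  have hint' : IntegrableOn (fun x => (u x).toReal) (Icc (0:ℝ) 1) := hint
  have : fSum P h ≤ ∫ t in Icc (0:ℝ) 1, (u t).toReal := by
    rw [← P.sum_setIntegral hint', fSum_real]
    refine Finset.sum_le_sum fun i _ => ?_
    rw [← P.setIntegral_const]
    have hsub := (P.Ioc_subset_ivl i).trans (P.ivl_subset i)
    refine setIntegral_mono_on_ae (by simp) (hint'.mono_set hsub) measurableSet_Ioc ?_
    filter_upwards [(ae_restrict_iff' measurableSet_Icc).1 hfin] with x hx hxi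
    have h1 := hδ' _ x (hP i (P.Ioc_subset_ivl i hxi))
    have h2 := hx (hsub hxi)
    have h3 : u x ≠ ⊥ := (bot_le.trans_lt h1).ne'
    rw [← EReal.coe_toReal h2.ne h3] at h1
    exact (EReal.coe_lt_coe_iff.1 h1).le
  linarith

/-- Riemann sums of a Lebesgue integrable function along sufficiently fine partitions approximate
its integral. -/
theorem exists_gauge_abs_fSum_sub_le {h : ℝ → ℝ} (hh : IntegrableOn h (Icc (0:ℝ) 1)) {ε : ℝ}
    (hε : 0 < ε) : ∃ δ : ℝ → ℝ, IsGauge δ ∧ ∀ (n : ℕ) (P : TP n), P.IsFine δ →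
      |fSum P h - ∫ t in Icc (0:ℝ) 1, h t| ≤ ε := by
  obtain ⟨δ, hδ, h1⟩ := exists_gauge_fSum_le hh hε
  obtain ⟨δ', hδ', h2⟩ := exists_gauge_fSum_le (h := fun t => - h t) hh.neg hε
  refine ⟨_, hδ.min hδ', fun n P hP => abs_le.2 ⟨?_, ?_⟩⟩
  · have := h2 n P (hP.mono fun t => min_le_right _ _)
    rw [fSum_neg, integral_neg] at this
    linarith
  · linarith [h1 n P (hP.mono fun t => min_le_left _ _)]

/-- A nonnegative measurable function whose Riemann sums along fine Perron partitions are bounded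
is Lebesgue integrable. -/
theorem integrableOn_of_fSum_le {h : ℝ → ℝ}
    (hm : AEMeasurable h (volume.restrict (Icc (0:ℝ) 1))) (h0 : ∀ t ∈ Icc (0:ℝ) 1, 0 ≤ h t)
    {C : ℝ} {δ : ℝ → ℝ} (hδ : IsGauge δ)
    (hC : ∀ (n : ℕ) (P : TP n), P.IsPerron → P.IsFine δ → fSum P h ≤ C) :
    IntegrableOn h (Icc (0:ℝ) 1) ∧ ∫ t in Icc (0:ℝ) 1, h t ≤ C := by
  have hae0 : 0 ≤ᵐ[volume.restrict (Icc (0:ℝ) 1)] h :=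
    (ae_restrict_iff' measurableSet_Icc).2 (Filter.Eventually.of_forall h0)
  have hmin0 : ∀ k : ℕ, 0 ≤ᵐ[volume.restrict (Icc (0:ℝ) 1)] fun t => min (h t) k := fun k => by
    filter_upwards [hae0] with t ht using le_min ht (Nat.cast_nonneg k)
  have hmk : ∀ k : ℕ, AEMeasurable (fun t => min (h t) k) (volume.restrict (Icc (0:ℝ) 1)) :=
    fun k => hm.min aemeasurable_const
  have htr : ∀ k : ℕ, IntegrableOn (fun t => min (h t) k) (Icc (0:ℝ) 1) := by
    intro k
    refine Integrable.of_bound (hmk k).aestronglyMeasurable k ?_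
    filter_upwards [hmin0 k] with t ht
    rw [Real.norm_of_nonneg ht]
    exact min_le_right _ _
  have hle : ∀ k : ℕ, ∫ t in Icc (0:ℝ) 1, min (h t) k ≤ C := by
    intro k
    refine le_of_forall_pos_le_add fun ε hε => ?_
    obtain ⟨δ', hδ', h1⟩ := exists_gauge_abs_fSum_sub_le (htr k) hε
    obtain ⟨n, P, hP, hf⟩ := exists_fine_perron (hδ.min hδ')
    have h2 := abs_le.1 (h1 n P (hf.mono fun t => min_le_right _ _))
    have h3 := hC n P hP (hf.mono fun t => min_le_left _ _)
    have h4 := fSum_mono P (h := fun t => min (h t) k) (h' := h) fun t _ => min_le_left _ _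
    linarith [h2.1]
  have hlint : ∫⁻ t in Icc (0:ℝ) 1, ENNReal.ofReal (h t) ≤ ENNReal.ofReal C := by
    have hsup : ∀ t, ENNReal.ofReal (h t) = ⨆ k : ℕ, ENNReal.ofReal (min (h t) k) := by
      intro t
      refine le_antisymm ?_ (iSup_le fun k => ENNReal.ofReal_le_ofReal (min_le_left _ _))
      obtain ⟨k, hk⟩ := exists_nat_ge (h t)
      exact (le_iSup (fun k : ℕ => ENNReal.ofReal (min (h t) k)) k).trans' (by simp [hk])
    simp_rw [hsup]
    rw [lintegral_iSup' (fun k => (hmk k).ennreal_ofReal)]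
    · refine iSup_le fun k => ?_
      rw [← ofReal_integral_eq_lintegral_ofReal (htr k) (hmin0 k)]
      exact ENNReal.ofReal_le_ofReal (hle k)
    · exact Filter.Eventually.of_forall fun t i j hij => ENNReal.ofReal_le_ofReal
        (min_le_min_left _ (Nat.cast_le.2 hij))
  have hint : IntegrableOn h (Icc (0:ℝ) 1) :=
    (lintegral_ofReal_ne_top_iff_integrable hm.aestronglyMeasurable hae0).1
      (hlint.trans_lt ENNReal.ofReal_lt_top).ne
  refine ⟨hint, ?_⟩
  have hC0 : 0 ≤ C := (integral_nonneg_of_ae (hmin0 0)).trans (hle 0)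
  rw [integral_eq_lintegral_of_nonneg_ae hae0 hm.aestronglyMeasurable]
  exact (ENNReal.toReal_mono ENNReal.ofReal_ne_top hlint).trans (ENNReal.toReal_ofReal hC0).le

/-! ### McShane integrability and approximation by step functions -/

/-- The step function with value `h (tag i)` on the `i`-th interval of the partition. -/
noncomputable def stepFn {n : ℕ} (P : TP n) (h : ℝ → ℝ) (x : ℝ) : ℝ :=
  ∑ i : Fin n, (Ioc (P.pt i.castSucc) (P.pt i.succ)).indicator (fun _ => h (P.tag i)) x

theorem stepFn_of_mem {n : ℕ} (P : TP n) (h : ℝ → ℝ) {x : ℝ} {i : Fin n}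
    (hx : x ∈ Ioc (P.pt i.castSucc) (P.pt i.succ)) : stepFn P h x = h (P.tag i) := by
  rw [stepFn, Finset.sum_eq_single i, indicator_of_mem hx]
  · intro j _ hj
    exact indicator_of_notMem (fun hx' => Set.disjoint_left.1 (P.pairwise_disjoint hj) hx' hx) _
  · simp

theorem measurable_stepFn {n : ℕ} (P : TP n) (h : ℝ → ℝ) : Measurable (stepFn P h) :=
  Finset.measurable_sum _ fun _ _ => measurable_const.indicator measurableSet_Ioc

theorem integrableOn_stepFn {n : ℕ} (P : TP n) (h : ℝ → ℝ) {E : Set ℝ}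
    (hE : E ⊆ Icc (0:ℝ) 1) : IntegrableOn (stepFn P h) E := by
  have : IntegrableOn (stepFn P h) (Icc (0:ℝ) 1) :=
    integrable_finsetSum _ fun _ _ => (integrable_const _).indicator measurableSet_Ioc
  exact this.mono_set hE

theorem setIntegral_stepFn {n : ℕ} (P : TP n) (h : ℝ → ℝ) {E : Set ℝ}
    (hE : E ⊆ Icc (0:ℝ) 1) : ∫ x in E, stepFn P h x =
      ∑ i : Fin n, volume.real (E ∩ Ioc (P.pt i.castSucc) (P.pt i.succ)) * h (P.tag i) := by
  have : IsFiniteMeasure (volume.restrict E) :=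
    ⟨by simpa using (measure_mono hE).trans_lt (by simp)⟩
  unfold stepFn
  rw [integral_finsetSum _ fun i _ => (integrable_const _).indicator measurableSet_Ioc]
  refine Finset.sum_congr rfl fun i _ => ?_
  rw [integral_indicator_const _ measurableSet_Ioc, measureReal_restrict_apply measurableSet_Ioc,
    inter_comm, smul_eq_mul]

theorem exists_gauge_fSum_indicator_sub_stepFn_le {h : ℝ → ℝ} {J ε : ℝ} {δ : ℝ → ℝ}
    (hδ : IsGauge δ) (hJ : ∀ (n : ℕ) (P : TP n), P.IsFine δ → |J - fSum P h| ≤ ε)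
    {n : ℕ} (P : TP n) (hP : P.IsFine δ) :
    ∃ δ₀ : ℝ → ℝ, IsGauge δ₀ ∧ ∀ (m : ℕ) (Q : TP m), Q.IsPerron → Q.IsFine δ₀ → ∀ A : Set ℝ,
      |fSum Q ((A \ range P.pt).indicator fun t => h t - stepFn P h t)| ≤ 2 * ε := by
  classical
  have hDc : IsClosed (range P.pt) := (finite_range _).isClosed
  have hDn : (range P.pt).Nonempty := range_nonempty _
  refine ⟨fun t => if t ∈ range P.pt then δ t else min (δ t) (infDist t (range P.pt)),
    fun t ht => ?_, fun m Q hQ hQf A => ?_⟩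
  · dsimp only
    split_ifs with h1
    · exact hδ t ht
    · exact lt_min (hδ t ht) ((hDc.notMem_iff_infDist_pos hDn).1 h1)
  have hex : ∀ j : Fin m, Q.tag j ∉ range P.pt →
      ∃ i : Fin n, Q.tag j ∈ Ioc (P.pt i.castSucc) (P.pt i.succ) := by
    intro j hj
    have h0 : Q.tag j ≠ 0 := fun h0 => hj ⟨0, by rw [P.first, h0]⟩
    have : Q.tag j ∈ Ioc (0:ℝ) 1 := ⟨(Q.tagMem j).1.lt_of_ne' h0, (Q.tagMem j).2⟩
    rwa [← P.iUnion_Ioc, mem_iUnion] at this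
  have : Nonempty (Fin n) := by
    by_contra hn
    have h0 : n = 0 := by simpa [← Fin.pos_iff_nonempty] using hn
    subst h0
    exact zero_ne_one (P.first.symm.trans P.last)
  choose! ι hι using hex
  set tag' : Fin m → ℝ := fun j =>
    if Q.tag j ∈ A \ range P.pt then P.tag (ι j) else Q.tag j with htag'
  let Q' : TP m := ⟨Q.pt, tag', Q.mono, Q.first, Q.last, fun j => by
    simp only [htag']
    split_ifs
    exacts [P.tagMem _, Q.tagMem _]⟩
  have hQ1 : Q.IsFine δ := hQf.mono fun t => by
    split_ifs
    exacts [le_rfl, min_le_left _ _]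
  have hQ2 : Q'.IsFine δ := by
    intro j
    by_cases hj : Q.tag j ∈ A \ range P.pt
    · have e : Q'.tag j = P.tag (ι j) := if_pos hj
      rw [e]
      refine Subset.trans (fun x hx => ?_) (hP (ι j))
      have h1 := hQf j hx
      simp only [if_neg hj.2] at h1
      have h2 := hι j hj.2
      have h3 : infDist (Q.tag j) (range P.pt) ≤ _ := infDist_le_dist_of_mem ⟨(ι j).castSucc, rfl⟩
      have h4 : infDist (Q.tag j) (range P.pt) ≤ _ := infDist_le_dist_of_mem ⟨(ι j).succ, rfl⟩
      rw [Real.dist_eq, abs_of_pos (by linarith [h2.1])] at h3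
      rw [Real.dist_eq, abs_of_nonpos (by linarith [h2.2])] at h4
      have h5 := min_le_right (δ (Q.tag j)) (infDist (Q.tag j) (range P.pt))
      exact ⟨by linarith [h1.1], by linarith [h1.2]⟩
    · have e : Q'.tag j = Q.tag j := if_neg hj
      rw [e]
      exact hQ1 j
  have hdiff : fSum Q ((A \ range P.pt).indicator fun t => h t - stepFn P h t) =
      fSum Q h - fSum Q' h := by
    simp only [fSum_real, ← Finset.sum_sub_distrib]
    refine Finset.sum_congr rfl fun j _ => ?_
    change Q.len j * _ = Q.len j * _ - Q.len j * h (tag' j)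
    by_cases hj : Q.tag j ∈ A \ range P.pt
    · rw [indicator_of_mem hj, stepFn_of_mem P h (hι j hj.2), htag']
      simp only [if_pos hj, mul_sub]
    · rw [indicator_of_notMem hj, htag']
      simp only [if_neg hj, mul_zero, sub_self]
  rw [hdiff]
  have h1 := abs_le.1 (hJ m Q hQ1)
  have h2 := abs_le.1 (hJ m Q' hQ2)
  exact abs_le.2 ⟨by linarith [h1.1, h1.2, h2.1, h2.2], by linarith [h1.1, h1.2, h2.1, h2.2]⟩

theorem integrableOn_and_setIntegral_sub_stepFn_le {h : ℝ → ℝ}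
    (hm : AEMeasurable h (volume.restrict (Icc (0:ℝ) 1))) {J ε : ℝ} {δ : ℝ → ℝ}
    (hδ : IsGauge δ) (hJ : ∀ (n : ℕ) (P : TP n), P.IsFine δ → |J - fSum P h| ≤ ε)
    {n : ℕ} (P : TP n) (hP : P.IsFine δ) :
    IntegrableOn h (Icc (0:ℝ) 1) ∧ ∫ t in Icc (0:ℝ) 1, |h t - stepFn P h t| ≤ 4 * ε := by
  obtain ⟨δ₀, hδ₀, hQ⟩ := exists_gauge_fSum_indicator_sub_stepFn_le hδ hJ P hP
  set k : ℝ → ℝ := fun t => h t - stepFn P h t with hk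
  set D := range P.pt with hD
  have hDm : MeasurableSet D := (finite_range _).measurableSet
  have hkm : AEMeasurable k (volume.restrict (Icc (0:ℝ) 1)) :=
    hm.sub (measurable_stepFn P h).aemeasurable
  have hae : (Dᶜ).indicator (fun t => |k t|) =ᵐ[volume.restrict (Icc (0:ℝ) 1)] fun t => |k t| := by
    refine ae_restrict_of_ae ?_
    have : ∀ᵐ t, t ∉ D := measure_eq_zero_iff_ae_notMem.1 ((finite_range _).measure_zero _)
    filter_upwards [this] with t ht
    exact indicator_of_mem ht _
  obtain ⟨h1, h2⟩ := integrableOn_of_fSum_le (h := (Dᶜ).indicator fun t => |k t|) (C := 4 * ε)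
    (hkm.abs.indicator hDm.compl)
    (fun t _ => indicator_nonneg (fun _ _ => abs_nonneg _) _) hδ₀ (fun m Q hQp hQf => by
      have e1 := abs_le.1 (hQ m Q hQp hQf {t | 0 ≤ k t})
      have e2 := abs_le.1 (hQ m Q hQp hQf {t | k t < 0})
      have e3 : (Dᶜ).indicator (fun t => |k t|) = fun t =>
          ({t | 0 ≤ k t} \ D).indicator k t - ({t | k t < 0} \ D).indicator k t := by
        funext t
        by_cases htD : t ∈ D
        · simp [htD]
        · rcases le_or_gt 0 (k t) with h0 | h0
          · simp [htD, h0, abs_of_nonneg h0]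
          · simp [htD, h0, abs_of_neg h0]
      rw [e3, fSum_sub]
      linarith [e1.2, e2.1])
  rw [integral_congr_ae hae] at h2
  have h3 : IntegrableOn (fun t => |k t|) (Icc (0:ℝ) 1) := h1.congr hae
  have h4 : IntegrableOn k (Icc (0:ℝ) 1) := (integrable_norm_iff hkm.aestronglyMeasurable).1 h3
  refine ⟨?_, h2⟩
  have := h4.add (integrableOn_stepFn P h subset_rfl)
  exact this.congr (Filter.Eventually.of_forall fun t => by simp [hk])

/-! ### Families of real functions -/

section

variable {S : Type*}

/-- Uniform integrability of a family of functions on `[0,1]`. -/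
def UnifInt (g : S → ℝ → ℝ) : Prop :=
  ∀ ε > 0, ∃ η > 0, ∀ A ⊆ Icc (0:ℝ) 1, NullMeasurableSet A volume → volume.real A ≤ η →
    ∀ s, ∫ t in A, |g s t| ≤ ε

/-- Boundedness of a family at every point of `[0,1]`. -/
def PtBdd (g : S → ℝ → ℝ) : Prop := ∀ t ∈ Icc (0:ℝ) 1, ∃ M : ℝ, ∀ s, |g s t| ≤ M

/-- McShane integrability of a family, uniformly with respect to the index. -/
def FamMcShane (g : S → ℝ → ℝ) (J : S → ℝ) : Prop :=
  ∀ ε > 0, ∃ δ : ℝ → ℝ, IsGauge δ ∧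
    ∀ (n : ℕ) (P : TP n), P.IsFine δ → ∀ s, |J s - fSum P (g s)| ≤ ε

/-- Birkhoff integrability of a family, uniformly with respect to the index. -/
def FamBirkhoff (g : S → ℝ → ℝ) (J : S → ℝ) : Prop :=
  ∀ ε > 0, ∃ δ : ℝ → ℝ, IsGauge δ ∧ AEMeasurable δ volume ∧
    ∀ (n : ℕ) (P : TP n), P.IsFine δ → ∀ s, |J s - fSum P (g s)| ≤ ε

/-- `ℋ`-integrability of a family, uniformly with respect to the index. -/
def FamHMeas (g : S → ℝ → ℝ) (J : S → ℝ) : Prop :=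
  ∀ ε > 0, ∃ δ : ℝ → ℝ, IsGauge δ ∧ AEMeasurable δ volume ∧
    ∀ (n : ℕ) (P : TP n), P.IsPerron → P.IsFine δ → ∀ s, |J s - fSum P (g s)| ≤ ε

theorem FamBirkhoff.famMcShane {g : S → ℝ → ℝ} {J : S → ℝ} (h : FamBirkhoff g J) :
    FamMcShane g J := fun ε hε =>
  let ⟨δ, h1, _, h2⟩ := h ε hε
  ⟨δ, h1, h2⟩

theorem FamMcShane.exists_stepFn {g : S → ℝ → ℝ} {J : S → ℝ} (h : FamMcShane g J)
    (hm : ∀ s, AEMeasurable (g s) (volume.restrict (Icc (0:ℝ) 1))) {ε : ℝ} (hε : 0 < ε) :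
    ∃ (n : ℕ) (P : TP n), ∀ s, ∫ t in Icc (0:ℝ) 1, |g s t - stepFn P (g s) t| ≤ ε := by
  obtain ⟨δ, hδ, hJ⟩ := h (ε / 4) (by positivity)
  obtain ⟨n, P, -, hP⟩ := exists_fine_perron hδ
  refine ⟨n, P, fun s => ?_⟩
  have := (integrableOn_and_setIntegral_sub_stepFn_le (hm s) hδ
    (fun n P hP => hJ n P hP s) P hP).2
  linarith

theorem FamMcShane.integrableOn {g : S → ℝ → ℝ} {J : S → ℝ} (h : FamMcShane g J)
    (hm : ∀ s, AEMeasurable (g s) (volume.restrict (Icc (0:ℝ) 1))) (s : S) :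
    IntegrableOn (g s) (Icc (0:ℝ) 1) := by
  obtain ⟨δ, hδ, hJ⟩ := h 1 one_pos
  obtain ⟨n, P, -, hP⟩ := exists_fine_perron hδ
  exact (integrableOn_and_setIntegral_sub_stepFn_le (hm s) hδ
    (fun n P hP => hJ n P hP s) P hP).1

theorem FamMcShane.unifInt {g : S → ℝ → ℝ} {J : S → ℝ} (h : FamMcShane g J)
    (hm : ∀ s, AEMeasurable (g s) (volume.restrict (Icc (0:ℝ) 1))) (hb : PtBdd g) :
    UnifInt g := by
  intro ε hε
  obtain ⟨n, P, hP⟩ := h.exists_stepFn hm (half_pos hε)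
  choose M hM using fun i => hb (P.tag i) (P.tagMem i)
  set K : ℝ := ∑ i, |M i| with hK
  have hK0 : 0 ≤ K := Finset.sum_nonneg fun i _ => abs_nonneg _
  have hstep : ∀ s x, |stepFn P (g s) x| ≤ K := by
    intro s x
    refine (Finset.abs_sum_le_sum_abs _ _).trans (Finset.sum_le_sum fun i _ => ?_)
    refine (norm_indicator_le_norm_self (E := ℝ) _ _).trans ?_
    exact (hM i s).trans (le_abs_self _)
  refine ⟨ε / 2 / (K + 1), by positivity, fun A hA hAm hAη s => ?_⟩
  have hAf : volume A ≠ ⊤ := ((measure_mono hA).trans_lt (by simp)).ne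
  have hi1 := h.integrableOn hm s
  have hi2 := integrableOn_stepFn P (g s) (subset_refl (Icc (0:ℝ) 1))
  have hi3 : IntegrableOn (fun t => |g s t - stepFn P (g s) t|) (Icc (0:ℝ) 1) :=
    (hi1.sub hi2).abs
  calc ∫ t in A, |g s t| ≤ ∫ t in A, (|g s t - stepFn P (g s) t| + K) := by
        refine integral_mono (hi1.mono_set hA).abs ((hi3.mono_set hA).add
          (integrableOn_const hAf)) fun t => ?_
        have := abs_add_le (g s t - stepFn P (g s) t) (stepFn P (g s) t)
        rw [sub_add_cancel] at this
        linarith [hstep s t]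
    _ = (∫ t in A, |g s t - stepFn P (g s) t|) + volume.real A * K := by
        rw [integral_add (hi3.mono_set hA) (integrableOn_const hAf)]
        simp
    _ ≤ ε / 2 + ε / 2 / (K + 1) * (K + 1) := by
        refine add_le_add ?_ ?_
        · exact (setIntegral_mono_set hi3 (Filter.Eventually.of_forall fun t => abs_nonneg _)
            hA.eventuallyLE).trans (hP s)
        · exact mul_le_mul hAη (by linarith) hK0 (by positivity)
    _ = ε := by field_simp; ring

theorem FamHMeas.eq_integral {g : S → ℝ → ℝ} {J : S → ℝ} (h : FamHMeas g J) {s : S}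
    (hi : IntegrableOn (g s) (Icc (0:ℝ) 1)) : J s = ∫ t in Icc (0:ℝ) 1, g s t := by
  refine eq_of_forall_dist_le fun ε hε => ?_
  obtain ⟨δ, hδ, -, h1⟩ := h (ε / 2) (by positivity)
  obtain ⟨δ', hδ', h2⟩ := exists_gauge_abs_fSum_sub_le hi (half_pos hε)
  obtain ⟨n, P, hP, hf⟩ := exists_fine_perron (hδ.min hδ')
  have h3 := abs_le.1 (h1 n P hP (hf.mono fun t => min_le_left _ _) s)
  have h4 := abs_le.1 (h2 n P (hf.mono fun t => min_le_right _ _))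
  rw [Real.dist_eq]
  exact abs_le.2 ⟨by linarith [h3.1, h4.1], by linarith [h3.2, h4.2]⟩

end

/-! ### Oscillation estimates for `ℋ`-integrable functions -/

theorem natFloor_eq_iff_mem_Ico {N : ℕ} (hN : 0 < N) {x : ℝ} (hx : 0 ≤ x) {j : ℕ} :
    ⌊N * x⌋₊ = j ↔ x ∈ Ico ((j : ℝ) / N) ((j + 1) / N) := by
  have hN' : (0:ℝ) < N := by exact_mod_cast hN
  rw [Nat.floor_eq_iff (by positivity), mem_Ico, div_le_iff₀ hN', lt_div_iff₀ hN', mul_comm]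

theorem exists_two_taggings {δ : ℝ → ℝ} (hδ : IsGauge δ) {N : ℕ} (hN : 0 < N) {t t' : ℕ → ℝ}
    (ht : ∀ k < N, t k = t' k ∨
      (FinePerron δ ((k : ℝ) / N) ((k + 1) / N) (t k) ∧
        FinePerron δ ((k : ℝ) / N) ((k + 1) / N) (t' k))) :
    ∃ (n n' : ℕ) (P : TP n) (P' : TP n'), P.IsPerron ∧ P.IsFine δ ∧ P'.IsPerron ∧ P'.IsFine δ ∧
      ∀ h : ℝ → ℝ, fSum P h - fSum P' h =
        ∑ k ∈ Finset.range N, (N : ℝ)⁻¹ * (h (t k) - h (t' k)) := by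
  have hN' : (0:ℝ) < N := by exact_mod_cast hN
  have key : ∀ m ≤ N, ∃ l l' : List (ℝ × ℝ × ℝ), TaggedChain (FinePerron δ) 0 ((m : ℝ) / N) l ∧
      TaggedChain (FinePerron δ) 0 ((m : ℝ) / N) l' ∧ ∀ h : ℝ → ℝ, listSum l h - listSum l' h =
        ∑ k ∈ Finset.range m, (N : ℝ)⁻¹ * (h (t k) - h (t' k)) := by
    intro m
    induction m with
    | zero =>
      intro _
      exact ⟨[], [], by simpa using TaggedChain.nil 0, by simpa using TaggedChain.nil 0,
        fun h => by simp⟩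
    | succ m ih =>
      intro hm
      obtain ⟨l, l', hl, hl', hs⟩ := ih (by omega)
      have hle : (m : ℝ) / N ≤ ((m + 1 : ℕ) : ℝ) / N := by push_cast; gcongr; linarith
      rcases ht m (by omega) with h1 | ⟨h1, h2⟩
      · obtain ⟨c, hc⟩ := exists_taggedChain hδ (a := (m : ℝ) / N) (b := ((m + 1 : ℕ) : ℝ) / N)
          (by positivity) hle ((div_le_one hN').2 (by exact_mod_cast hm))
        refine ⟨l ++ c, l' ++ c, hl.append hc, hl'.append hc, fun h => ?_⟩
        rw [listSum_append, listSum_append, Finset.sum_range_succ, ← hs h, h1]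
        ring
      · rw [← Nat.cast_succ] at h1 h2
        refine ⟨_, _, hl.append (.single hle h1), hl'.append (.single hle h2), fun h => ?_⟩
        rw [listSum_append, listSum_append, Finset.sum_range_succ, ← hs h]
        simp only [listSum, List.map_cons, List.map_nil, List.sum_cons, List.sum_nil]
        push_cast
        field_simp
        ring
  obtain ⟨l, l', hl, hl', hs⟩ := key N le_rfl
  rw [div_self hN'.ne'] at hl hl'
  obtain ⟨n, P, h1, h2, h3⟩ := hl.exists_TP
  obtain ⟨n', P', h1', h2', h3'⟩ := hl'.exists_TP
  exact ⟨n, n', P, P', h1, h2, h1', h2', fun h => by rw [h3, h3', hs]⟩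

theorem exists_oscillation_bound {h : ℝ → ℝ} {J ε : ℝ} (hε : 0 < ε) {δ : ℝ → ℝ} (hδ : IsGauge δ)
    (hJ : ∀ (n : ℕ) (P : TP n), P.IsPerron → P.IsFine δ → |J - fSum P h| ≤ ε) {N : ℕ}
    (hN : 0 < N) {E : Set ℝ} (hE : E ⊆ Ico 0 1) (hEδ : ∀ t ∈ E, (N : ℝ)⁻¹ < δ t) :
    ∃ O : ℝ → ℝ, (∀ x, 0 ≤ O x) ∧ IntegrableOn O (Icc (0:ℝ) 1) ∧
      ∫ x in Icc (0:ℝ) 1, O x ≤ 3 * ε ∧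
      ∀ t ∈ E, ∀ t' ∈ E, ∀ x : ℝ, 0 ≤ x → ⌊N * t'⌋₊ = ⌊N * t⌋₊ → ⌊N * x⌋₊ = ⌊N * t⌋₊ →
        |h t - h t'| ≤ O x := by
  have hN' : (0:ℝ) < N := by exact_mod_cast hN
  have hfp : ∀ t ∈ E, FinePerron δ ((⌊N * t⌋₊ : ℝ) / N) ((⌊N * t⌋₊ + 1) / N) t := by
    intro t ht
    have h1 := (natFloor_eq_iff_mem_Ico hN (hE ht).1).1 rfl
    have h2 := hEδ t ht
    refine ⟨Ico_subset_Icc_self h1, Ico_subset_Icc_self (hE ht), fun x hx => ?_⟩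
    rw [add_div] at hx h1
    rw [one_div] at hx h1
    exact ⟨by linarith [h1.2, hx.1], by linarith [h1.1, hx.2]⟩
  have hlt : ∀ t ∈ E, ⌊N * t⌋₊ < N := fun t ht => by
    rw [Nat.floor_lt (by have := (hE ht).1; positivity)]
    nlinarith [(hE ht).2]
  have hsum : ∀ t t' : ℕ → ℝ, (∀ k < N, t k = t' k ∨
      (t k ∈ E ∧ t' k ∈ E ∧ ⌊N * t k⌋₊ = k ∧ ⌊N * t' k⌋₊ = k)) →
      ∑ k ∈ Finset.range N, (N : ℝ)⁻¹ * (h (t k) - h (t' k)) ≤ 2 * ε := by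
    intro t t' htt
    obtain ⟨n, n', P, P', h1, h2, h3, h4, h5⟩ := exists_two_taggings hδ hN (t := t) (t' := t')
      fun k hk => (htt k hk).imp_right fun ⟨a, b, c, d⟩ => by
        have e1 := hfp _ a
        have e2 := hfp _ b
        rw [c] at e1
        rw [d] at e2
        exact ⟨e1, e2⟩
    rw [← h5]
    have e1 := abs_le.1 (hJ n P h1 h2)
    have e2 := abs_le.1 (hJ n' P' h3 h4)
    linarith [e1.1, e2.2]
  set T : ℕ → Set ℝ := fun k =>
    {r | ∃ t ∈ E, ∃ t' ∈ E, ⌊N * t⌋₊ = k ∧ ⌊N * t'⌋₊ = k ∧ r = h t - h t'} with hT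
  have hTb : ∀ k, ∀ r ∈ T k, r ≤ 2 * ε * N := by
    rintro k r ⟨t, ht, t', ht', h1, h2, rfl⟩
    have := hsum (fun j => if j = k then t else 0) (fun j => if j = k then t' else 0)
      (fun j _ => by by_cases hj : j = k <;> simp [hj, ht, ht', h1, h2])
    rw [Finset.sum_eq_single k] at this
    · simp only [if_true] at this
      rw [inv_mul_le_iff₀ hN'] at this
      linarith
    · intro j _ hj
      simp [hj]
    · intro hk
      exact absurd (Finset.mem_range.2 (h1 ▸ hlt t ht)) hk
  have hTbdd : ∀ k, BddAbove (T k) := fun k => ⟨_, hTb k⟩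
  set o : ℕ → ℝ := fun k => sSup (T k) with ho
  have ho0 : ∀ k, 0 ≤ o k := by
    intro k
    rcases (T k).eq_empty_or_nonempty with he | ⟨r, t, ht, t', ht', h1, h2, rfl⟩
    · simp [ho, he]
    · exact le_csSup (hTbdd k) ⟨t, ht, t, ht, h1, h1, by simp⟩
  have hex : ∀ k, ∃ p : ℝ × ℝ, (p.1 = p.2 ∨
      (p.1 ∈ E ∧ p.2 ∈ E ∧ ⌊N * p.1⌋₊ = k ∧ ⌊N * p.2⌋₊ = k)) ∧ o k ≤ h p.1 - h p.2 + ε := by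
    intro k
    rcases (T k).eq_empty_or_nonempty with he | hne
    · exact ⟨(0, 0), Or.inl rfl, by simp [ho, he, hε.le]⟩
    · obtain ⟨r, ⟨t, ht, t', ht', h1, h2, rfl⟩, hr⟩ :=
        exists_lt_of_lt_csSup hne (sub_lt_self (o k) hε)
      exact ⟨(t, t'), Or.inr ⟨ht, ht', h1, h2⟩, by linarith⟩
  choose p hp hpo using hex
  have hosum : ∑ k ∈ Finset.range N, (N : ℝ)⁻¹ * o k ≤ 3 * ε := by
    have h1 := hsum (fun k => (p k).1) (fun k => (p k).2) fun k _ => hp k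
    calc ∑ k ∈ Finset.range N, (N : ℝ)⁻¹ * o k
        ≤ ∑ k ∈ Finset.range N, ((N : ℝ)⁻¹ * (h (p k).1 - h (p k).2) + (N : ℝ)⁻¹ * ε) :=
          Finset.sum_le_sum fun k _ => by
            rw [← mul_add]
            exact mul_le_mul_of_nonneg_left (hpo k) (by positivity)
      _ ≤ 2 * ε + ε := by
          rw [Finset.sum_add_distrib, Finset.sum_const, Finset.card_range, nsmul_eq_mul,
            mul_inv_cancel_left₀ hN'.ne']
          linarith
      _ = 3 * ε := by ring
  refine ⟨fun x => ∑ k ∈ Finset.range N,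
    (Ico ((k : ℝ) / N) ((k + 1) / N)).indicator (fun _ => o k) x, fun x =>
      Finset.sum_nonneg fun k _ => indicator_nonneg (fun _ _ => ho0 k) _, ?_, ?_, ?_⟩
  · exact integrable_finsetSum _ fun _ _ => (integrable_const _).indicator measurableSet_Ico
  · rw [integral_finsetSum _ fun i _ => (integrable_const _).indicator measurableSet_Ico]
    refine (Finset.sum_le_sum fun k _ => ?_).trans hosum
    rw [integral_indicator_const _ measurableSet_Ico, smul_eq_mul]
    refine mul_le_mul_of_nonneg_right ?_ (ho0 k)
    rw [measureReal_restrict_apply measurableSet_Ico]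
    refine (measureReal_mono inter_subset_left (by simp)).trans_eq ?_
    rw [Real.volume_real_Ico_of_le (by gcongr; linarith), add_div]
    simp
  · intro t ht t' ht' x hx h1 h2
    have h3 : |h t - h t'| ≤ o ⌊N * t⌋₊ := abs_le.2 ⟨by
      rw [neg_le, neg_sub]
      exact le_csSup (hTbdd _) ⟨t', ht', t, ht, h1, rfl, rfl⟩,
      le_csSup (hTbdd _) ⟨t, ht, t', ht', rfl, h1, rfl⟩⟩
    refine h3.trans ?_
    refine le_trans ?_ (Finset.single_le_sum (fun k _ => indicator_nonneg (fun _ _ => ho0 k) _)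
      (Finset.mem_range.2 (hlt t ht)))
    rw [indicator_of_mem ((natFloor_eq_iff_mem_Ico hN hx).1 h2)]

/-- The set of points of `[0,1)` where the gauge exceeds `1/N`. -/
def gaugeSet (δ : ℝ → ℝ) (N : ℕ) : Set ℝ := {t | t ∈ Ico (0:ℝ) 1 ∧ (N : ℝ)⁻¹ < δ t}

theorem nullMeasurableSet_gaugeSet {δ : ℝ → ℝ} (hm : AEMeasurable δ volume) (N : ℕ) :
    NullMeasurableSet (gaugeSet δ N) volume :=
  measurableSet_Ico.nullMeasurableSet.inter (nullMeasurableSet_lt aemeasurable_const hm)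

theorem exists_measure_diff_gaugeSet_le {δ : ℝ → ℝ} (hδ : IsGauge δ) (hm : AEMeasurable δ volume)
    {θ : ℝ≥0∞} (hθ : 0 < θ) : ∃ N : ℕ, 0 < N ∧ volume (Icc (0:ℝ) 1 \ gaugeSet δ N) ≤ θ := by
  have h1 : Filter.Tendsto (fun n : ℕ => volume (Icc (0:ℝ) 1 \ gaugeSet δ (n + 1))) Filter.atTop
      (nhds (volume (⋂ n : ℕ, Icc (0:ℝ) 1 \ gaugeSet δ (n + 1)))) := by
    refine tendsto_measure_iInter_atTop (fun n => measurableSet_Icc.nullMeasurableSet.diff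
      (nullMeasurableSet_gaugeSet hm _)) (fun m n hmn => ?_)
      ⟨0, ((measure_mono sdiff_subset).trans_lt (by simp)).ne⟩
    refine sdiff_subset_sdiff_right fun t ht => ⟨ht.1, lt_of_le_of_lt ?_ ht.2⟩
    gcongr
  have h2 : volume (⋂ n : ℕ, Icc (0:ℝ) 1 \ gaugeSet δ (n + 1)) = 0 := by
    refine measure_mono_null (t := {1}) (fun t ht => ?_) (by simp)
    rw [mem_iInter] at ht
    by_contra hne
    have ht0 := (ht 0).1
    obtain ⟨n, hn⟩ := exists_nat_one_div_lt (hδ t ht0)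
    exact (ht n).2 ⟨⟨ht0.1, lt_of_le_of_ne ht0.2 hne⟩, by simpa using hn⟩
  rw [h2] at h1
  obtain ⟨n, hn⟩ := (h1.eventually (ge_mem_nhds hθ)).exists
  exact ⟨n + 1, by omega, hn⟩

theorem FamHMeas.aemeasurable {S : Type*} {g : S → ℝ → ℝ} {J : S → ℝ} (h : FamHMeas g J) (s : S) :
    AEMeasurable (g s) (volume.restrict (Icc (0:ℝ) 1)) := by
  choose δ hδ hm hJ using fun k : ℕ => h ((1 / 2 : ℝ) ^ k) (by positivity)
  choose N hN hNv using fun k : ℕ => exists_measure_diff_gaugeSet_le (hδ k) (hm k)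
    (θ := ENNReal.ofReal ((1 / 2 : ℝ) ^ k)) (by positivity)
  choose O hO0 hOi hOle hO using fun k : ℕ => exists_oscillation_bound (by positivity) (hδ k)
    (fun n P h1 h2 => hJ k n P h1 h2 s) (hN k) (E := gaugeSet (δ k) (N k)) (fun t ht => ht.1)
    fun t ht => ht.2
  have hc : ∀ k j : ℕ, ∃ c : ℝ, (∃ t ∈ gaugeSet (δ k) (N k), ⌊N k * t⌋₊ = j) →
      c ∈ gaugeSet (δ k) (N k) ∧ ⌊N k * c⌋₊ = j := by
    intro k j
    by_cases hex : ∃ t ∈ gaugeSet (δ k) (N k), ⌊N k * t⌋₊ = j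
    · obtain ⟨t, ht⟩ := hex
      exact ⟨t, fun _ => ht⟩
    · exact ⟨0, fun h => absurd h hex⟩
  choose c hc using hc
  have hsum : ∑' k : ℕ, ENNReal.ofReal ((1 / 2 : ℝ) ^ k) ≠ ⊤ :=
    (summable_geometric_of_lt_one (by norm_num) (by norm_num)).tsum_ofReal_ne_top
  have hsum3 : ∑' k : ℕ, ENNReal.ofReal (3 * (1 / 2 : ℝ) ^ k) ≠ ⊤ :=
    ((summable_geometric_of_lt_one (by norm_num) (by norm_num)).mul_left 3).tsum_ofReal_ne_top
  have hae1 : ∀ᵐ t ∂volume, ∀ᶠ k in Filter.atTop, t ∉ Icc (0:ℝ) 1 \ gaugeSet (δ k) (N k) :=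
    ae_eventually_notMem ((ENNReal.tsum_le_tsum hNv).trans_lt hsum.lt_top).ne
  have hae2 : ∀ᵐ t ∂volume.restrict (Icc (0:ℝ) 1),
      ∑' k, ENNReal.ofReal (O k t) < ⊤ := by
    refine ae_lt_top' ?_ ?_
    · exact AEMeasurable.tsum fun k => (hOi k).aemeasurable.ennreal_ofReal
    · rw [lintegral_tsum fun k => (hOi k).aemeasurable.ennreal_ofReal]
      refine ((ENNReal.tsum_le_tsum fun k => ?_).trans_lt hsum3.lt_top).ne
      rw [← ofReal_integral_eq_lintegral_ofReal (hOi k) (Filter.Eventually.of_forall (hO0 k))]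
      exact ENNReal.ofReal_le_ofReal (hOle k)
  have hu : ∀ k, AEMeasurable (fun t : ℝ => g s (c k ⌊N k * t⌋₊)) (volume.restrict (Icc (0:ℝ) 1)) :=
    fun k => ((measurable_of_countable (fun j : ℕ => g s (c k j))).comp
      (Nat.measurable_floor.comp (measurable_const.mul measurable_id))).aemeasurable
  refine aemeasurable_of_tendsto_metrizable_ae Filter.atTop hu ?_
  filter_upwards [ae_restrict_of_ae hae1, hae2, ae_restrict_mem measurableSet_Icc]
    with t h1 h2 ht
  have h3 : Filter.Tendsto (fun k => O k t) Filter.atTop (nhds 0) := by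
    have := (ENNReal.tendsto_toReal ENNReal.zero_ne_top).comp
      (ENNReal.tendsto_atTop_zero_of_tsum_ne_top h2.ne)
    simpa [Function.comp_def, ENNReal.toReal_ofReal (hO0 _ _)] using this
  rw [tendsto_iff_dist_tendsto_zero]
  refine squeeze_zero' (Filter.Eventually.of_forall fun k => dist_nonneg) ?_ h3
  filter_upwards [h1] with k hk
  have htE : t ∈ gaugeSet (δ k) (N k) := by
    by_contra hcon
    exact hk ⟨ht, hcon⟩
  obtain ⟨h4, h5⟩ := hc k ⌊N k * t⌋₊ ⟨t, htE, rfl⟩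
  rw [Real.dist_eq]
  exact hO k _ h4 t htE t ht.1 h5.symm h5.symm

/-! ### From `ℋ`-integrability and uniform integrability to Birkhoff integrability -/

section

variable {S : Type*}

/-- On `A`, the values of the family approximate the nearby values up to an error of integral at
most `e`, in a way which is uniform in the index. -/
def LocallyApprox (g : S → ℝ → ℝ) (A : Set ℝ) (e : ℝ) : Prop :=
  ∃ ρ : ℝ → ℝ, Measurable ρ ∧ (∀ t ∈ A ∩ Icc 0 1, 0 < ρ t) ∧ ∀ s, ∃ F : ℝ → ℝ, (∀ x, 0 ≤ F x) ∧
    IntegrableOn F (Icc (0:ℝ) 1) ∧ ∫ x in Icc (0:ℝ) 1, F x ≤ e ∧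
    ∀ t ∈ A ∩ Icc 0 1, ∀ x ∈ Icc (0:ℝ) 1, |x - t| < ρ t → |g s t - g s x| ≤ F x

theorem exists_measurable_gauge_of_cover {g : S → ℝ → ℝ}
    (hi : ∀ s, IntegrableOn (g s) (Icc (0:ℝ) 1)) {A : ℕ → Set ℝ}
    (hA : ∀ k, NullMeasurableSet (A k) volume) (hcov : ∀ t, ∃ k, t ∈ A k)
    (hloc : ∀ k, ∀ e > 0, LocallyApprox g (A k) e) {ε : ℝ} (hε : 0 < ε) :
    ∃ δ : ℝ → ℝ, IsGauge δ ∧ AEMeasurable δ volume ∧ ∀ (n : ℕ) (P : TP n), P.IsFine δ →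
      ∀ s, |(∫ t in Icc (0:ℝ) 1, g s t) - fSum P (g s)| ≤ ε := by
  classical
  choose ρ hρm hρ0 hF using fun k => hloc k (ε / 2 / 2 ^ k) (by positivity)
  set κ : ℝ → ℕ := fun t => Nat.find (hcov t) with hκ
  have hκA : ∀ t, t ∈ A (κ t) := fun t => Nat.find_spec (hcov t)
  have hlevel : ∀ k, NullMeasurableSet {t | κ t = k} volume := by
    intro k
    have : {t | κ t = k} = A k \ ⋃ i ∈ Finset.range k, A i := by
      ext t
      simp [hκ, Nat.find_eq_iff]
    rw [this]
    exact (hA k).diff (Finset.nullMeasurableSet_biUnion _ fun i _ => hA i)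
  refine ⟨fun t => ρ (κ t) t, fun t ht => hρ0 _ t ⟨hκA t, ht⟩, ?_, fun n P hP s => ?_⟩
  · have hu : (⋃ k, {t | κ t = k}) = univ := by ext t; simp
    rw [← Measure.restrict_univ (μ := (volume : Measure ℝ)), ← hu, aemeasurable_iUnion_iff]
    intro k
    refine ((hρm k).aemeasurable).congr ?_
    refine (ae_restrict_iff'₀ (hlevel k)).2 (Filter.Eventually.of_forall fun t ht => ?_)
    rw [mem_ofPred_eq] at ht
    simp only [ht]
  · choose F hF0 hFi hFle hFb using fun k => hF k s
    set K : Finset ℕ := Finset.univ.image fun i => κ (P.tag i) with hK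
    have hint : ∀ i : Fin n, IntegrableOn (g s) (Ioc (P.pt i.castSucc) (P.pt i.succ)) := fun i =>
      (hi s).mono_set ((P.Ioc_subset_ivl i).trans (P.ivl_subset i))
    have hFint : IntegrableOn (fun x => ∑ k ∈ K, F k x) (Icc (0:ℝ) 1) :=
      integrable_finsetSum _ fun k _ => hFi k
    rw [← P.sum_setIntegral (hi s), fSum_real, ← Finset.sum_sub_distrib]
    calc |∑ i : Fin n, ((∫ x in Ioc (P.pt i.castSucc) (P.pt i.succ), g s x) -
          P.len i * g s (P.tag i))|
        ≤ ∑ i : Fin n, |(∫ x in Ioc (P.pt i.castSucc) (P.pt i.succ), g s x) -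
          P.len i * g s (P.tag i)| :=
          Finset.abs_sum_le_sum_abs _ _
      _ ≤ ∑ i : Fin n, ∫ x in Ioc (P.pt i.castSucc) (P.pt i.succ), ∑ k ∈ K, F k x := by
          refine Finset.sum_le_sum fun i _ => ?_
          rw [← P.setIntegral_const, ← integral_sub (hint i) (by simp)]
          rw [← Real.norm_eq_abs]
          refine norm_integral_le_of_norm_le (hFint.mono_set
            ((P.Ioc_subset_ivl i).trans (P.ivl_subset i))) ?_
          refine (ae_restrict_iff' measurableSet_Ioc).2 (Filter.Eventually.of_forall fun x hx => ?_)
          have hx1 := P.Ioc_subset_ivl i hx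
          have hx2 := hP i hx1
          rw [Real.norm_eq_abs, abs_sub_comm]
          refine (hFb (κ (P.tag i)) (P.tag i) ⟨hκA _, P.tagMem i⟩ x (P.ivl_subset i hx1)
            (abs_lt.2 ⟨by linarith [hx2.1], by linarith [hx2.2]⟩)).trans ?_
          exact Finset.single_le_sum (f := fun k => F k x) (fun k _ => hF0 k x)
            (Finset.mem_image_of_mem (fun i => κ (P.tag i)) (Finset.mem_univ i))
      _ = ∑ k ∈ K, ∫ x in Icc (0:ℝ) 1, F k x := by
          rw [P.sum_setIntegral hFint, integral_finsetSum _ fun k _ => hFi k]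
      _ ≤ ∑ k ∈ K, ε / 2 / 2 ^ k := Finset.sum_le_sum fun k _ => hFle k
      _ ≤ ε := ((summable_geometric_two' ε).sum_le_tsum K fun k _ => by positivity).trans_eq
          (tsum_geometric_two' ε)

theorem exists_measurable_radius {V : Set ℝ} (hV : IsOpen V) :
    ∃ ρ : ℝ → ℝ, Measurable ρ ∧ (∀ t ∈ V, 0 < ρ t) ∧ ∀ t x, |x - t| < ρ t → x ∈ V := by
  rcases (Vᶜ).eq_empty_or_nonempty with h | h
  · refine ⟨fun _ => 1, measurable_const, fun _ _ => one_pos, fun t x _ => ?_⟩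
    rw [compl_empty_iff.1 h]
    trivial
  · refine ⟨fun t => infDist t Vᶜ, measurable_infDist, fun t ht => ?_, fun t x hx => ?_⟩
    · exact (hV.isClosed_compl.notMem_iff_infDist_pos h).1 fun h => h ht
    · by_contra hxV
      have := infDist_le_dist_of_mem (x := t) (s := Vᶜ) hxV
      rw [Real.dist_eq, abs_sub_comm] at this
      linarith

theorem integrableOn_indicator_const_add_abs {h : ℝ → ℝ} (hi : IntegrableOn h (Icc (0:ℝ) 1))
    {W : Set ℝ} (hW : W ⊆ Icc 0 1) (hWm : NullMeasurableSet W volume) (M : ℝ) :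
    IntegrableOn (W.indicator fun x => M + |h x|) (Icc (0:ℝ) 1) ∧
      ∫ x in Icc (0:ℝ) 1, W.indicator (fun x => M + |h x|) x =
        volume.real W * M + ∫ x in W, |h x| := by
  have hWf : volume W ≠ ⊤ := ((measure_mono hW).trans_lt (by simp)).ne
  have hWm' : NullMeasurableSet W (volume.restrict (Icc (0:ℝ) 1)) :=
    hWm.mono_ac Measure.restrict_le_self.absolutelyContinuous
  have h1 : IntegrableOn (fun x => M + |h x|) (Icc (0:ℝ) 1) :=
    Integrable.add (integrable_const M) hi.abs
  have h2 : IntegrableOn (fun _ => M) W := integrableOn_const hWf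
  refine ⟨h1.indicator₀ hWm', ?_⟩
  rw [integral_indicator₀ hWm', Measure.restrict_restrict_of_subset hW,
    integral_add h2 (hi.mono_set hW).abs]
  simp

theorem LocallyApprox.of_null {g : S → ℝ → ℝ} (hi : ∀ s, IntegrableOn (g s) (Icc (0:ℝ) 1))
    (hui : UnifInt g) {A : Set ℝ} (hA : volume (A ∩ Icc 0 1) = 0) {M : ℝ} (hM0 : 0 ≤ M)
    (hM : ∀ t ∈ A ∩ Icc 0 1, ∀ s, |g s t| ≤ M) {e : ℝ} (he : 0 < e) : LocallyApprox g A e := by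
  obtain ⟨η, hη, hη'⟩ := hui (e / 2) (by positivity)
  set θ : ℝ := min η (e / 2 / (M + 1)) with hθ
  have hθ0 : 0 < θ := lt_min hη (by positivity)
  obtain ⟨V, hAV, hVo, hV⟩ := (A ∩ Icc 0 1).exists_isOpen_lt_of_lt (ENNReal.ofReal θ)
    (by rw [hA]; exact ENNReal.ofReal_pos.2 hθ0 : volume (A ∩ Icc 0 1) < _)
  obtain ⟨ρ, hρm, hρ0, hρ⟩ := exists_measurable_radius hVo
  have hWm : NullMeasurableSet (V ∩ Icc (0:ℝ) 1) volume :=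
    (hVo.measurableSet.inter measurableSet_Icc).nullMeasurableSet
  have hWθ : volume.real (V ∩ Icc (0:ℝ) 1) ≤ θ :=
    ENNReal.toReal_le_of_le_ofReal hθ0.le ((measure_mono inter_subset_left).trans hV.le)
  refine ⟨ρ, hρm, fun t ht => hρ0 t (hAV ht), fun s =>
    ⟨(V ∩ Icc (0:ℝ) 1).indicator fun x => M + |g s x|,
      fun x => indicator_nonneg (fun x _ => by positivity) x, ?_, ?_, fun t ht x hx hxt => ?_⟩⟩
  · exact (integrableOn_indicator_const_add_abs (hi s) inter_subset_right hWm M).1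
  · rw [(integrableOn_indicator_const_add_abs (hi s) inter_subset_right hWm M).2]
    have h1 := hη' _ inter_subset_right hWm (hWθ.trans (min_le_left _ _)) s
    have h2 : volume.real (V ∩ Icc (0:ℝ) 1) * M ≤ e / 2 / (M + 1) * (M + 1) :=
      mul_le_mul (hWθ.trans (min_le_right _ _)) (by linarith) hM0 (by positivity)
    rw [div_mul_cancel₀ _ (by positivity)] at h2
    linarith
  · have hxW : x ∈ V ∩ Icc (0:ℝ) 1 := ⟨hρ t x hxt, hx⟩
    rw [indicator_of_mem hxW]
    have := abs_sub (g s t) (g s x)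
    linarith [hM t ht s]

theorem LocallyApprox.of_gauge {g : S → ℝ → ℝ} {J : S → ℝ}
    (hi : ∀ s, IntegrableOn (g s) (Icc (0:ℝ) 1)) (hui : UnifInt g) (hb : PtBdd g) {ε : ℝ}
    (hε : 0 < ε) {δ : ℝ → ℝ} (hδ : IsGauge δ)
    (hJ : ∀ (n : ℕ) (P : TP n), P.IsPerron → P.IsFine δ → ∀ s, |J s - fSum P (g s)| ≤ ε)
    {N : ℕ} (hN : 0 < N) {H : Set ℝ} (hH : H ⊆ gaugeSet δ N) (hHm : NullMeasurableSet H volume)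
    (hirr : ∀ t ∈ H, Irrational t) : LocallyApprox g H (5 * ε) := by
  have hN' : (0:ℝ) < N := by exact_mod_cast hN
  have hHI : H ⊆ Icc 0 1 := fun t ht => Ico_subset_Icc_self (hH ht).1
  have hc : ∀ j : ℕ, ∃ c ∈ Icc (0:ℝ) 1, (∃ t ∈ H, ⌊N * t⌋₊ = j) → c ∈ H ∧ ⌊N * c⌋₊ = j := by
    intro j
    by_cases hex : ∃ t ∈ H, ⌊N * t⌋₊ = j
    · obtain ⟨t, ht⟩ := hex
      exact ⟨t, hHI ht.1, fun _ => ht⟩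
    · exact ⟨0, by simp, fun h => absurd h hex⟩
  choose c hcI hc using hc
  choose B hB using fun j => hb (c j) (hcI j)
  set M : ℝ := ∑ j ∈ Finset.range N, |B j| with hM
  have hM0 : 0 ≤ M := Finset.sum_nonneg fun _ _ => abs_nonneg _
  have hlt : ∀ t ∈ H, ⌊N * t⌋₊ < N := fun t ht => by
    rw [Nat.floor_lt (by have := (hHI ht).1; positivity)]
    nlinarith [(hH ht).1.2]
  have hcM : ∀ t ∈ H, ∀ s, |g s (c ⌊N * t⌋₊)| ≤ M := fun t ht s =>
    ((hB _ s).trans (le_abs_self _)).trans (Finset.single_le_sum (f := fun j => |B j|)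
      (fun _ _ => abs_nonneg _) (Finset.mem_range.2 (hlt t ht)))
  obtain ⟨η, hη, hη'⟩ := hui ε hε
  set θ : ℝ := min η (ε / (M + 1)) with hθ
  have hθ0 : 0 < θ := lt_min hη (by positivity)
  have hHf : volume H ≠ ⊤ := ((measure_mono hHI).trans_lt (by simp)).ne
  obtain ⟨V, hHV, hVo, hV⟩ := H.exists_isOpen_lt_of_lt (volume H + ENNReal.ofReal θ)
    (ENNReal.lt_add_right hHf (ENNReal.ofReal_pos.2 hθ0).ne' : volume H < _)
  obtain ⟨ρ, hρm, hρ0, hρ⟩ := exists_measurable_radius hVo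
  set W : Set ℝ := (V \ H) ∩ Icc 0 1 with hW
  have hWm : NullMeasurableSet W volume :=
    (hVo.measurableSet.nullMeasurableSet.diff hHm).inter measurableSet_Icc.nullMeasurableSet
  have hWθ : volume.real W ≤ θ := by
    refine ENNReal.toReal_le_of_le_ofReal hθ0.le ((measure_mono inter_subset_left).trans ?_)
    rw [measure_sdiff hHV hHm hHf]
    exact tsub_le_iff_left.2 hV.le
  refine ⟨fun t => min (ρ t) (min (N * t - ⌊N * t⌋₊) (⌊N * t⌋₊ + 1 - N * t) / N), ?_, ?_, ?_⟩
  · have h1 : Measurable fun t : ℝ => N * t := measurable_const.mul measurable_id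
    have h2 : Measurable fun t : ℝ => (⌊N * t⌋₊ : ℝ) :=
      (measurable_of_countable (fun j : ℕ => (j : ℝ))).comp (Nat.measurable_floor.comp h1)
    exact hρm.min (((h1.sub h2).min ((h2.add_const 1).sub h1)).div_const _)
  · rintro t ⟨ht, -⟩
    refine lt_min (hρ0 t (hHV ht)) (div_pos (lt_min (sub_pos.2 ?_) (sub_pos.2 ?_)) hN')
    · refine lt_of_le_of_ne (Nat.floor_le (by have := (hHI ht).1; positivity)) fun heq => ?_
      refine hirr t ht ⟨(⌊N * t⌋₊ : ℚ) / N, ?_⟩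
      push_cast
      rw [heq]
      field_simp
    · exact Nat.lt_floor_add_one _
  intro s
  obtain ⟨O, hO0, hOi, hOle, hO⟩ := exists_oscillation_bound hε hδ
    (fun n P h1 h2 => hJ n P h1 h2 s) hN (E := H) (fun t ht => (hH ht).1) fun t ht => (hH ht).2
  obtain ⟨hWi, hWe⟩ := integrableOn_indicator_const_add_abs (hi s) (W := W) inter_subset_right
    hWm M
  refine ⟨fun x => O x + W.indicator (fun x => M + |g s x|) x, fun x =>
    add_nonneg (hO0 x) (indicator_nonneg (fun x _ => by positivity) x), hOi.add hWi, ?_, ?_⟩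
  · rw [integral_add hOi hWi, hWe]
    have h1 := hη' W inter_subset_right hWm (hWθ.trans (min_le_left _ _)) s
    have h2 : volume.real W * M ≤ ε / (M + 1) * (M + 1) :=
      mul_le_mul (hWθ.trans (min_le_right _ _)) (by linarith) hM0 (by positivity)
    rw [div_mul_cancel₀ _ (by positivity)] at h2
    linarith
  · rintro t ⟨ht, htI⟩ x hx hxt
    have hxV := hρ t x (hxt.trans_le (min_le_left _ _))
    have hcell : ⌊N * x⌋₊ = ⌊N * t⌋₊ := by
      have h1 := hxt.trans_le (min_le_right _ _)
      rw [lt_div_iff₀ hN', lt_min_iff] at h1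
      rw [Nat.floor_eq_iff (by have := hx.1; positivity)]
      have h2 := neg_abs_le (x - t)
      have h3 := le_abs_self (x - t)
      constructor <;> nlinarith
    by_cases hxH : x ∈ H
    · exact (hO t ht x hxH x hx.1 hcell hcell).trans
        (le_add_of_nonneg_right (indicator_nonneg (fun x _ => by positivity) x))
    · have hxW : x ∈ W := ⟨⟨hxV, hxH⟩, hx⟩
      beta_reduce
      rw [indicator_of_mem hxW]
      obtain ⟨h1, h2⟩ := hc ⌊N * t⌋₊ ⟨t, ht, rfl⟩
      have h3 := hO t ht _ h1 x hx.1 h2 hcell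
      have h4 := hcM t ht s
      rw [abs_le] at h3 h4 ⊢
      have h5 := neg_abs_le (g s x)
      have h6 := le_abs_self (g s x)
      constructor <;> linarith [h3.1, h3.2, h4.1, h4.2]

theorem FamHMeas.famBirkhoff {g : S → ℝ → ℝ} {J : S → ℝ} (h : FamHMeas g J)
    (hi : ∀ s, IntegrableOn (g s) (Icc (0:ℝ) 1)) (hui : UnifInt g) (hb : PtBdd g) :
    FamBirkhoff g J := by
  have hJe : ∀ s, J s = ∫ t in Icc (0:ℝ) 1, g s t := fun s => h.eq_integral (hi s)
  choose δ hδ hm hJ using fun k : ℕ => h ((1 / 2 : ℝ) ^ k) (by positivity)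
  choose N hN hNv using fun k : ℕ => exists_measure_diff_gaugeSet_le (hδ k) (hm k)
    (θ := ENNReal.ofReal ((1 / 2 : ℝ) ^ k)) (by positivity)
  set H : ℕ → Set ℝ := fun m =>
    (⋂ k : ℕ, gaugeSet (δ (m + k)) (N (m + k))) \ range ((↑) : ℚ → ℝ) with hH
  have hHm : ∀ m, NullMeasurableSet (H m) volume := fun m =>
    (NullMeasurableSet.iInter fun k => nullMeasurableSet_gaugeSet (hm _) _).diff
      (countable_range _).measurableSet.nullMeasurableSet
  have hHl : ∀ m, ∀ e > 0, LocallyApprox g (H m) e := by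
    intro m e he
    obtain ⟨k, hk⟩ := exists_pow_lt_of_lt_one (show 0 < e / 5 by positivity)
      (show (1 / 2 : ℝ) < 1 by norm_num)
    have hk' : (1 / 2 : ℝ) ^ (m + k) ≤ e / 5 :=
      (pow_le_pow_of_le_one (by norm_num) (by norm_num) (Nat.le_add_left k m)).trans hk.le
    obtain ⟨ρ, h1, h2, h3⟩ := LocallyApprox.of_gauge hi hui hb (by positivity) (hδ (m + k))
      (hJ (m + k)) (hN (m + k)) (H := H m) (fun t ht => mem_iInter.1 ht.1 k) (hHm m)
      (fun t ht => ht.2)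
    refine ⟨ρ, h1, h2, fun s => ?_⟩
    obtain ⟨F, h4, h5, h6, h7⟩ := h3 s
    exact ⟨F, h4, h5, by linarith, h7⟩
  have hsum : ∑' k : ℕ, ENNReal.ofReal ((1 / 2 : ℝ) ^ k) ≠ ⊤ :=
    (summable_geometric_of_lt_one (by norm_num) (by norm_num)).tsum_ofReal_ne_top
  have hnull : volume ((⋃ m, H m)ᶜ ∩ Icc 0 1) = 0 := by
    have h1 : ∀ᵐ t ∂volume, ∀ᶠ k in Filter.atTop, t ∉ Icc (0:ℝ) 1 \ gaugeSet (δ k) (N k) :=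
      ae_eventually_notMem ((ENNReal.tsum_le_tsum hNv).trans_lt hsum.lt_top).ne
    have h2 : ∀ᵐ t : ℝ, t ∉ range ((↑) : ℚ → ℝ) :=
      measure_eq_zero_iff_ae_notMem.1 ((countable_range _).measure_zero _)
    rw [measure_eq_zero_iff_ae_notMem]
    filter_upwards [h1, h2] with t h1 h2
    rintro ⟨h3, h4⟩
    obtain ⟨m, hm⟩ := Filter.eventually_atTop.1 h1
    refine h3 (mem_iUnion.2 ⟨m, mem_iInter.2 fun k => ?_, h2⟩)
    by_contra h5
    exact hm (m + k) (Nat.le_add_right m k) ⟨h4, h5⟩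
  set Z : ℕ → Set ℝ := fun m =>
    {t | t ∉ ⋃ m, H m} ∩ {t | t ∈ Icc (0:ℝ) 1 → ∀ s, |g s t| ≤ m} with hZ
  have hZn : ∀ m, volume (Z m ∩ Icc 0 1) = 0 := fun m =>
    measure_mono_null (inter_subset_inter_left _ inter_subset_left) hnull
  have hZm : ∀ m, NullMeasurableSet (Z m) volume := by
    intro m
    have h1 : Z m = (Z m ∩ Icc 0 1) ∪ ((⋃ m, H m)ᶜ \ Icc 0 1) := by
      ext t
      by_cases ht : t ∈ Icc (0:ℝ) 1
      · simp only [mem_union, mem_inter_iff, mem_sdiff, ht]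
        tauto
      · simp only [hZ, mem_union, mem_inter_iff, mem_sdiff, ht, mem_ofPred_eq, mem_compl_iff]
        tauto
    rw [h1]
    exact (NullMeasurableSet.of_null (hZn m)).union
      ((NullMeasurableSet.iUnion hHm).compl.diff measurableSet_Icc.nullMeasurableSet)
  have hZl : ∀ m, ∀ e > 0, LocallyApprox g (Z m) e := fun m e he =>
    LocallyApprox.of_null hi hui (hZn m) (Nat.cast_nonneg m) (fun t ht => ht.1.2 ht.2) he
  obtain ⟨φ, hφ⟩ := exists_surjective_nat (ℕ ⊕ ℕ)
  intro ε hε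
  obtain ⟨δ', h1, h2, h3⟩ := exists_measurable_gauge_of_cover hi
    (A := fun k => Sum.elim H Z (φ k))
    (fun k => by rcases φ k with m | m; exacts [hHm m, hZm m])
    (fun t => by
      by_cases ht : t ∈ ⋃ m, H m
      · obtain ⟨m, hm⟩ := mem_iUnion.1 ht
        obtain ⟨k, hk⟩ := hφ (Sum.inl m)
        exact ⟨k, by rw [hk]; exact hm⟩
      · obtain ⟨m, hm⟩ : ∃ m : ℕ, t ∈ Icc (0:ℝ) 1 → ∀ s, |g s t| ≤ m := by
          by_cases htI : t ∈ Icc (0:ℝ) 1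
          · obtain ⟨M, hM⟩ := hb t htI
            obtain ⟨m, hm⟩ := exists_nat_ge M
            exact ⟨m, fun _ s => (hM s).trans hm⟩
          · exact ⟨0, fun h => absurd h htI⟩
        obtain ⟨k, hk⟩ := hφ (Sum.inr m)
        exact ⟨k, by rw [hk]; exact ⟨ht, hm⟩⟩)
    (fun k => by rcases φ k with m | m; exacts [hHl m, hZl m]) hε
  exact ⟨δ', h1, h2, fun n P hP s => by rw [hJe s]; exact h3 n P hP s⟩

end

/-! ### Convex weakly compact sets and support functions -/

theorem continuous_weakSpace_eval (x' : X →L[ℝ] ℝ) :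
    Continuous fun y : WeakSpace ℝ X => x' ((toWeakSpace ℝ X).symm y) :=
  WeakBilin.eval_continuous (topDualPairing ℝ X).flip x'

theorem IsCWK.isCompact_image {A : Set X} (hA : IsCWK X A) (x' : X →L[ℝ] ℝ) :
    IsCompact (x' '' A) := by
  have := hA.2.2.image (continuous_weakSpace_eval x')
  rwa [image_image] at this

theorem IsCWK.isBounded {A : Set X} (hA : IsCWK X A) : Bornology.IsBounded A := by
  obtain ⟨C, hC⟩ := banach_steinhaus (ι := A) (E := X →L[ℝ] ℝ) (F := ℝ)
    (g := fun x => NormedSpace.inclusionInDoubleDual ℝ X x) fun x' => by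
      obtain ⟨C, hC⟩ := (hA.isCompact_image x').isBounded.exists_norm_le
      exact ⟨C, fun x => hC _ ⟨x, x.2, rfl⟩⟩
  refine isBounded_iff_forall_norm_le.2 ⟨C, fun x hx => ?_⟩
  have := hC ⟨x, hx⟩
  rwa [← (NormedSpace.inclusionInDoubleDualLi ℝ (E := X)).norm_map x]

theorem bddAbove_image {A : Set X} (hA : Bornology.IsBounded A) (x' : X →L[ℝ] ℝ) :
    BddAbove (x' '' A) := (x'.lipschitz.isBounded_image hA).bddAbove

theorem le_suppFn {A : Set X} (hA : Bornology.IsBounded A) (x' : X →L[ℝ] ℝ) {x : X} (hx : x ∈ A) :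
    x' x ≤ suppFn x' A := le_csSup (bddAbove_image hA x') ⟨x, hx, rfl⟩

theorem suppFn_le {A : Set X} (hA : A.Nonempty) {x' : X →L[ℝ] ℝ} {c : ℝ}
    (h : ∀ x ∈ A, x' x ≤ c) : suppFn x' A ≤ c :=
  csSup_le (hA.image _) (forall_mem_image.2 h)

theorem IsCWK.exists_eq_suppFn {A : Set X} (hA : IsCWK X A) (x' : X →L[ℝ] ℝ) :
    ∃ x ∈ A, x' x = suppFn x' A := (hA.isCompact_image x').sSup_mem (hA.1.image _)

theorem suppFn_add_le {A : Set X} (hne : A.Nonempty) (hA : Bornology.IsBounded A)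
    (x' y' : X →L[ℝ] ℝ) : suppFn (x' + y') A ≤ suppFn x' A + suppFn y' A :=
  suppFn_le hne fun _ hx => add_le_add (le_suppFn hA x' hx) (le_suppFn hA y' hx)

theorem suppFn_smul {A : Set X} {c : ℝ} (hc : 0 ≤ c) (x' : X →L[ℝ] ℝ) :
    suppFn (c • x') A = c * suppFn x' A := by
  rw [suppFn, suppFn, ← smul_eq_mul, ← Real.sSup_smul_of_nonneg hc]
  congr 1
  ext r
  simp [mem_smul_set]

theorem abs_suppFn_le {A : Set X} (hne : A.Nonempty) {C : ℝ} (hC : ∀ x ∈ A, ‖x‖ ≤ C)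
    (x' : X →L[ℝ] ℝ) : |suppFn x' A| ≤ C * ‖x'‖ := by
  have hA : Bornology.IsBounded A := isBounded_iff_forall_norm_le.2 ⟨C, hC⟩
  have key : ∀ x ∈ A, |x' x| ≤ C * ‖x'‖ := fun x hx => by
    rw [mul_comm]
    exact (x'.le_opNorm x).trans (mul_le_mul_of_nonneg_left (hC x hx) (norm_nonneg _))
  obtain ⟨a, ha⟩ := hne
  exact abs_le.2 ⟨(abs_le.1 (key a ha)).1.trans (le_suppFn hA x' ha),
    suppFn_le ⟨a, ha⟩ fun x hx => (abs_le.1 (key x hx)).2⟩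

theorem neg_suppFn_neg_le {A : Set X} (hA : Bornology.IsBounded A) (x' : X →L[ℝ] ℝ) {x : X}
    (hx : x ∈ A) : - suppFn (-x') A ≤ x' x := by
  have := le_suppFn hA (-x') hx
  rw [neg_apply] at this
  linarith

theorem suppFn_add_set {A B : Set X} (hA : A.Nonempty) (hA' : Bornology.IsBounded A)
    (hB : B.Nonempty) (hB' : Bornology.IsBounded B) (x' : X →L[ℝ] ℝ) :
    suppFn x' (A + B) = suppFn x' A + suppFn x' B := by
  rw [suppFn, image_add, csSup_add (hA.image _) (bddAbove_image hA' x') (hB.image _)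
    (bddAbove_image hB' x')]
  rfl

theorem suppFn_smul_set (A : Set X) {c : ℝ} (hc : 0 ≤ c) (x' : X →L[ℝ] ℝ) :
    suppFn x' (c • A) = c * suppFn x' A := by
  rw [suppFn, image_smul_set, Real.sSup_smul_of_nonneg hc]
  rfl

theorem mSum_spec {n : ℕ} (P : TP n) {Γ : ℝ → Set X} (hΓ : ∀ t ∈ Icc (0:ℝ) 1, IsCWK X (Γ t)) :
    (mSum P Γ).Nonempty ∧ Bornology.IsBounded (mSum P Γ) ∧ Convex ℝ (mSum P Γ) ∧
      ∀ x' : X →L[ℝ] ℝ, suppFn x' (mSum P Γ) = fSum P fun t => suppFn x' (Γ t) := by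
  classical
  unfold mSum fSum
  induction (Finset.univ : Finset (Fin n)) using Finset.induction_on with
  | empty =>
    rw [Finset.sum_empty, ← singleton_zero]
    exact ⟨singleton_nonempty _, Bornology.isBounded_singleton, convex_singleton _, fun x' => by
      simp [suppFn]⟩
  | insert i s hi ih =>
    obtain ⟨h1, h2, h3, h4⟩ := ih
    have hi' := hΓ _ (P.tagMem i)
    have g1 : (P.len i • Γ (P.tag i)).Nonempty := hi'.1.smul_set
    have g2 : Bornology.IsBounded (P.len i • Γ (P.tag i)) := hi'.isBounded.smul₀ _
    have g3 : Convex ℝ (P.len i • Γ (P.tag i)) := hi'.2.1.smul _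
    rw [Finset.sum_insert hi]
    refine ⟨g1.add h1, g2.add h2, g3.add h3, fun x' => ?_⟩
    rw [Finset.sum_insert hi, suppFn_add_set g1 g2 h1 h2, h4,
      suppFn_smul_set _ (P.len_nonneg i), smul_eq_mul]

theorem apply_fSum {n : ℕ} (P : TP n) (f : ℝ → X) (x' : X →L[ℝ] ℝ) :
    x' (fSum P f) = fSum P fun t => x' (f t) := by
  simp [fSum]

theorem fSum_mem_mSum {n : ℕ} (P : TP n) {Γ : ℝ → Set X} {f : ℝ → X} (hf : Selection Γ f) :
    fSum P f ∈ mSum P Γ :=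
  Set.finsetSum_mem_finsetSum _ _ _ fun i _ => smul_mem_smul_set (hf _ (P.tagMem i))

/-! ### The finite intersection property and representation of functionals -/

theorem IsCWK.exists_forall_le {A : Set X} (hA : IsCWK X A) {ι : Type*} (x' : ι → X →L[ℝ] ℝ)
    (c : ι → ℝ) (h : ∀ u : Finset ι, ∃ x ∈ A, ∀ i ∈ u, x' i x ≤ c i) :
    ∃ x ∈ A, ∀ i, x' i x ≤ c i := by
  obtain ⟨y, ⟨x, hx, rfl⟩, hy⟩ := hA.2.2.inter_iInter_nonempty
    (fun i => {y : WeakSpace ℝ X | x' i ((toWeakSpace ℝ X).symm y) ≤ c i})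
    (fun i => isClosed_le (continuous_weakSpace_eval _) continuous_const) fun u => by
      obtain ⟨x, hx, hxu⟩ := h u
      exact ⟨toWeakSpace ℝ X x, mem_image_of_mem _ hx, by simpa using hxu⟩
  exact ⟨x, hx, by simpa using hy⟩

theorem IsCWK.exists_representing {A : Set X} (hA : IsCWK X A) (φ : (X →L[ℝ] ℝ) →ₗ[ℝ] ℝ)
    (hφ : ∀ x', φ x' ≤ suppFn x' A) : ∃ x ∈ A, ∀ x' : X →L[ℝ] ℝ, x' x = φ x' := by
  obtain ⟨x, hx, h⟩ := hA.exists_forall_le (fun x' : X →L[ℝ] ℝ => x') φ fun u => by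
    classical
    set L : X →L[ℝ] (u → ℝ) := ContinuousLinearMap.pi fun i => i.1 with hL
    have hcpt : IsCompact (L '' A) := by
      have h1 : Continuous fun y : WeakSpace ℝ X => L ((toWeakSpace ℝ X).symm y) :=
        continuous_pi fun i => continuous_weakSpace_eval i.1
      have := hA.2.2.image h1
      rwa [image_image] at this
    have hconv : Convex ℝ (L '' A) := hA.2.1.linear_image L.toLinearMap
    have hmem : (fun i : u => φ i.1) ∈ L '' A := by
      by_contra hcon
      obtain ⟨f, r, h1, h2⟩ := geometric_hahn_banach_closed_point hconv hcpt.isClosed hcon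
      have hf : ∀ v : u → ℝ, f v = ∑ i, v i * f (Pi.single i 1) := fun v => by
        have := LinearMap.pi_apply_eq_sum_univ f.toLinearMap v
        simp only [smul_eq_mul] at this
        refine this.trans (Finset.sum_congr rfl fun i _ => ?_)
        have e : (fun j : u => if i = j then (1:ℝ) else 0) = Pi.single i 1 := by
          ext j
          simp [Pi.single_apply, eq_comm]
        rw [e]
        rfl
      set z : X →L[ℝ] ℝ := ∑ i : u, f (Pi.single i 1) • i.1 with hz
      have hz1 : φ z = f fun i : u => φ i.1 := by
        rw [hf, hz, map_sum]
        simp [mul_comm]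
      have hz2 : ∀ x, z x = f (L x) := fun x => by
        rw [hf, hz, sum_apply]
        simp [hL, mul_comm]
      have := hφ z
      rw [hz1] at this
      exact absurd (this.trans (suppFn_le hA.1 fun x hx => by
        rw [hz2]; exact (h1 _ ⟨x, hx, rfl⟩).le)) (not_le.2 h2)
    obtain ⟨x, hx, hxe⟩ := hmem
    exact ⟨x, hx, fun x' hx' => (congrFun hxe ⟨x', hx'⟩).le⟩
  refine ⟨x, hx, fun x' => le_antisymm (h x') ?_⟩
  have := h (-x')
  rw [map_neg, neg_apply] at this
  linarith

theorem IsCWK.mem_of_forall_le {A : Set X} (hA : IsCWK X A) {x : X}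
    (hx : ∀ x' : X →L[ℝ] ℝ, x' x ≤ suppFn x' A) : x ∈ A := by
  obtain ⟨y, hy, h⟩ := hA.exists_representing
    (ContinuousLinearMap.apply ℝ ℝ x : (X →L[ℝ] ℝ) →L[ℝ] ℝ).toLinearMap hx
  have : y = x := by
    by_contra hne
    obtain ⟨f, hf⟩ := geometric_hahn_banach_point_point hne
    exact hf.ne (h f)
  exact this ▸ hy

theorem IsCWK.exists_suppFn_eq {I : Set X} (hI : IsCWK X I) {h : (X →L[ℝ] ℝ) → ℝ}
    (hadd : ∀ x' y', h (x' + y') ≤ h x' + h y') (hsmul : ∀ c > 0, ∀ x', h (c • x') = c * h x')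
    {ν : X} (hle : ∀ x', h x' + x' ν ≤ suppFn x' I) :
    ∃ W, IsCWK X W ∧ ∀ x', suppFn x' W = h x' := by
  set W : Set X := {x | ∀ x' : X →L[ℝ] ℝ, x' x ≤ h x'} with hW
  have hWI : ∀ x ∈ W, x + ν ∈ I := fun x hx => hI.mem_of_forall_le fun x' => by
    rw [map_add]
    linarith [hx x', hle x']
  have h0 : ∀ x', 0 ≤ h x' + h (-x') := by
    intro x'
    have h1 := hsmul 2 two_pos 0
    rw [smul_zero] at h1
    have h2 := hadd x' (-x')
    rw [add_neg_cancel] at h2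
    linarith
  have hmax : ∀ x₀, ∃ w ∈ W, x₀ w = h x₀ := by
    intro x₀
    have h00 : h 0 = 0 := by
      have h1 := hsmul 2 two_pos 0
      rw [smul_zero] at h1
      linarith
    obtain ⟨φ, hφ1, hφ2⟩ : ∃ φ : (X →L[ℝ] ℝ) →ₗ[ℝ] ℝ, φ x₀ = h x₀ ∧ ∀ x', φ x' ≤ h x' := by
      by_cases hx0 : x₀ = 0
      · obtain ⟨φ, -, h2⟩ := exists_extension_of_le_sublinear ⟨⊥, 0⟩ h hsmul hadd (fun x => by
          have : (x : X →L[ℝ] ℝ) = 0 := (Submodule.mem_bot ℝ).1 x.2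
          rw [this, h00]
          simp)
        exact ⟨φ, by rw [hx0, map_zero, h00], h2⟩
      · obtain ⟨φ, h1, h2⟩ := exists_extension_of_le_sublinear
          (LinearPMap.mkSpanSingleton x₀ (h x₀) hx0) h hsmul hadd (fun x => by
            obtain ⟨x, hx⟩ := x
            obtain ⟨c, rfl⟩ := Submodule.mem_span_singleton.1 hx
            rw [LinearPMap.mkSpanSingleton'_apply]
            change c • h x₀ ≤ h (c • x₀)
            rcases lt_trichotomy c 0 with hc | hc | hc
            · have := hsmul (-c) (by linarith) (-x₀)
              rw [smul_neg, neg_smul, neg_neg] at this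
              rw [this, smul_eq_mul]
              nlinarith [h0 x₀]
            · simp [hc, h00]
            · rw [hsmul c hc, smul_eq_mul])
        refine ⟨φ, ?_, h2⟩
        have := h1 ⟨x₀, Submodule.mem_span_singleton_self x₀⟩
        rw [LinearPMap.mkSpanSingleton_apply] at this
        exact this
    obtain ⟨y, hy, hye⟩ := hI.exists_representing
      (φ + (ContinuousLinearMap.apply ℝ ℝ ν : (X →L[ℝ] ℝ) →L[ℝ] ℝ).toLinearMap) fun x' => by
        change φ x' + x' ν ≤ _
        linarith [hφ2 x', hle x']
    have hye' : ∀ x' : X →L[ℝ] ℝ, x' (y - ν) = φ x' := fun x' => by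
      rw [map_sub, hye x']
      exact add_sub_cancel_right _ _
    exact ⟨y - ν, fun x' => by rw [hye']; exact hφ2 x', by rw [hye', hφ1]⟩
  have hne : W.Nonempty := let ⟨w, hw, _⟩ := hmax 0; ⟨w, hw⟩
  have hcpt : IsCompact (toWeakSpace ℝ X '' W) := by
    have h1 : IsClosed {y : WeakSpace ℝ X | ∀ x' : X →L[ℝ] ℝ,
        x' ((toWeakSpace ℝ X).symm y) ≤ h x'} := by
      simp only [ofPred_forall]
      exact isClosed_iInter fun x' => isClosed_le (continuous_weakSpace_eval x') continuous_const
    have h2 : IsCompact ((fun y => y - toWeakSpace ℝ X ν) '' (toWeakSpace ℝ X '' I)) :=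
      hI.2.2.image (continuous_id.sub continuous_const)
    refine IsCompact.of_isClosed_subset h2 (t := toWeakSpace ℝ X '' W) ?_ ?_
    · convert h1 using 1
      ext y
      constructor
      · rintro ⟨x, hx, rfl⟩
        exact fun x' => by simpa using hx x'
      · intro hy
        exact ⟨(toWeakSpace ℝ X).symm y, hy, by simp⟩
    · rintro - ⟨x, hx, rfl⟩
      exact ⟨_, ⟨_, hWI x hx, rfl⟩, by simp⟩
  refine ⟨W, ⟨hne, ?_, hcpt⟩, fun x' => le_antisymm (suppFn_le hne fun x hx => hx x') ?_⟩
  · intro x hx y hy a b ha hb hab x'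
    rw [map_add, map_smul, map_smul, smul_eq_mul, smul_eq_mul]
    have := hx x'
    have := hy x'
    calc a * x' x + b * x' y ≤ a * h x' + b * h x' := by gcongr
      _ = h x' := by rw [← add_mul, hab, one_mul]
  · obtain ⟨w, hw, hwe⟩ := hmax x'
    rw [← hwe]
    refine le_csSup ⟨h x', ?_⟩ ⟨w, hw, rfl⟩
    rintro - ⟨x, hx, rfl⟩
    exact hx x'

/-! ### The Hausdorff distance through support functions -/

theorem abs_suppFn_sub_le_hausdorffDist {A B : Set X} (hA : A.Nonempty)
    (hA' : Bornology.IsBounded A) (hB : B.Nonempty) (hB' : Bornology.IsBounded B)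
    {x' : X →L[ℝ] ℝ} (hx' : ‖x'‖ ≤ 1) : |suppFn x' A - suppFn x' B| ≤ hausdorffDist A B := by
  have key : ∀ {A B : Set X}, A.Nonempty → Bornology.IsBounded A → B.Nonempty →
      Bornology.IsBounded B → suppFn x' A ≤ suppFn x' B + hausdorffDist A B := by
    intro A B hA hA' hB hB'
    refine suppFn_le hA fun a ha => le_of_forall_pos_le_add fun ε hε => ?_
    obtain ⟨b, hb, hab⟩ := exists_dist_lt_of_hausdorffDist_lt ha
      (lt_add_of_pos_right (hausdorffDist A B) hε)
      (hausdorffEDist_ne_top_of_nonempty_of_bounded hA hB hA' hB')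
    have h1 := le_suppFn hB' x' hb
    have h2 : x' (a - b) ≤ 1 * ‖a - b‖ := (le_abs_self _).trans (x'.le_of_opNorm_le hx' _)
    rw [map_sub, one_mul, ← dist_eq_norm] at h2
    linarith
  have h1 := key hA hA' hB hB'
  have h2 := key hB hB' hA hA'
  rw [hausdorffDist_comm] at h2
  exact abs_le.2 ⟨by linarith, by linarith⟩

theorem infDist_le_of_suppFn_le {A B : Set X} (hA' : Bornology.IsBounded A) (hB : B.Nonempty)
    (hBc : Convex ℝ B) {ε : ℝ}
    (h : ∀ x' : X →L[ℝ] ℝ, ‖x'‖ ≤ 1 → suppFn x' A ≤ suppFn x' B + ε) {a : X} (ha : a ∈ A) :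
    infDist a B ≤ ε := by
  have hε : 0 ≤ ε := by
    have := h 0 (by simp)
    simpa [suppFn, Nonempty.image_const hB, Nonempty.image_const ⟨a, ha⟩] using this
  by_contra! hcon
  obtain ⟨r, hr, hr'⟩ := exists_between hcon
  have hr0 : 0 < r := hε.trans_lt hr
  have hdisj : Disjoint (ball a (infDist a B)) B := disjoint_ball_infDist
  obtain ⟨f, u, h1, h2⟩ := geometric_hahn_banach_open (convex_ball a _) isOpen_ball hBc hdisj
  have hfa : f a < u := h1 a (mem_ball_self (hr0.trans hr'))
  have hball : ∀ y : X, ‖y‖ = r → f y ≤ u - f a := fun y hy => by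
    have := h1 (a + y) (by simpa [hy] using hr')
    rw [map_add] at this
    linarith
  have hnorm : ‖f‖ ≤ (u - f a) / r := by
    refine f.opNorm_le_bound (div_nonneg (by linarith) hr0.le) fun x => ?_
    rcases eq_or_ne x 0 with rfl | hx
    · simp
    have hx' : 0 < ‖x‖ := norm_pos_iff.2 hx
    have e1 : ‖(r / ‖x‖) • x‖ = r := by
      rw [norm_smul, Real.norm_of_nonneg (by positivity), div_mul_cancel₀ _ hx'.ne']
    have h3 := hball _ e1
    have h4 := hball (-((r / ‖x‖) • x)) (by rw [norm_neg, e1])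
    rw [map_neg] at h4
    have h5 : |f ((r / ‖x‖) • x)| ≤ u - f a := abs_le.2 ⟨by linarith, h3⟩
    rw [map_smul, smul_eq_mul, abs_mul, abs_of_pos (by positivity), div_mul_eq_mul_div,
      div_le_iff₀ hx'] at h5
    rw [Real.norm_eq_abs, div_mul_eq_mul_div, le_div_iff₀ hr0]
    linarith
  obtain ⟨b, hb⟩ := hB
  have hf0 : 0 < ‖f‖ := norm_pos_iff.2 fun h0 => by
    have := h2 b hb
    rw [h0] at this hfa
    simp only [zero_apply] at this hfa
    linarith
  have h6 := h (-(‖f‖⁻¹ • f)) (by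
    rw [norm_neg, norm_smul, norm_inv, norm_norm, inv_mul_cancel₀ hf0.ne'])
  have h7 := le_suppFn hA' (-(‖f‖⁻¹ • f)) ha
  have h8 : suppFn (-(‖f‖⁻¹ • f)) B ≤ -(‖f‖⁻¹ * u) := suppFn_le ⟨b, hb⟩ fun y hy => by
    have := h2 y hy
    simp only [neg_apply, smul_apply, smul_eq_mul]
    gcongr
  simp only [neg_apply, smul_apply, smul_eq_mul] at h7
  rw [le_div_iff₀ hr0, ← le_inv_mul_iff₀ hf0] at hnorm
  linarith

theorem hausdorffDist_le_of_abs_suppFn_sub_le {A B : Set X} (hA : A.Nonempty)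
    (hA' : Bornology.IsBounded A) (hAc : Convex ℝ A) (hB : B.Nonempty)
    (hB' : Bornology.IsBounded B) (hBc : Convex ℝ B) {ε : ℝ} (hε : 0 ≤ ε)
    (h : ∀ x' : X →L[ℝ] ℝ, ‖x'‖ ≤ 1 → |suppFn x' A - suppFn x' B| ≤ ε) :
    hausdorffDist A B ≤ ε :=
  hausdorffDist_le_of_infDist hε
    (fun _ ha => infDist_le_of_suppFn_le hA' hB hBc
      (fun x' hx' => by linarith [(abs_le.1 (h x' hx')).2]) ha)
    fun _ hb => infDist_le_of_suppFn_le hB' hA hAc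
      (fun x' hx' => by linarith [(abs_le.1 (h x' hx')).1]) hb

/-! ### Gauge integrals as uniform gauge integrals of scalar families -/

variable (X) in
/-- The closed unit ball of the dual space. -/
abbrev DualBall : Type _ := {x' : X →L[ℝ] ℝ // ‖x'‖ ≤ 1}

/-- The family of support functions of a multifunction. -/
noncomputable def suppFam (Γ : ℝ → Set X) (x' : DualBall X) (t : ℝ) : ℝ := suppFn x'.1 (Γ t)

/-- The family of scalar compositions of a function. -/
def applyFam (f : ℝ → X) (x' : DualBall X) (t : ℝ) : ℝ := x'.1 (f t)

theorem hausdorffDist_mSum_le_iff {I : Set X} (hI : IsCWK X I) {Γ : ℝ → Set X}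
    (hΓ : ∀ t ∈ Icc (0:ℝ) 1, IsCWK X (Γ t)) {n : ℕ} (P : TP n) {ε : ℝ} (hε : 0 ≤ ε) :
    hausdorffDist I (mSum P Γ) ≤ ε ↔
      ∀ x' : DualBall X, |suppFn x'.1 I - fSum P (suppFam Γ x')| ≤ ε := by
  obtain ⟨h1, h2, h3, h4⟩ := mSum_spec P hΓ
  unfold suppFam
  simp_rw [← h4]
  exact ⟨fun h x' => (abs_suppFn_sub_le_hausdorffDist hI.1 hI.isBounded h1 h2 x'.2).trans h,
    fun h => hausdorffDist_le_of_abs_suppFn_sub_le hI.1 hI.isBounded hI.2.1 h1 h2 h3 hε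
      fun x' hx' => h ⟨x', hx'⟩⟩

theorem norm_le_iff_forall_dualBall {x : X} {ε : ℝ} :
    ‖x‖ ≤ ε ↔ ∀ x' : DualBall X, |x'.1 x| ≤ ε := by
  refine ⟨fun h x' => ((x'.1.le_of_opNorm_le x'.2 x).trans_eq (one_mul _)).trans h, fun h => ?_⟩
  obtain ⟨x', h1, h2⟩ := exists_dual_vector'' ℝ x
  have := h ⟨x', h1⟩
  change |x' x| ≤ ε at this
  rw [h2] at this
  exact (le_abs_self _).trans this

theorem norm_sub_fSum_le_iff {w : X} {f : ℝ → X} {n : ℕ} (P : TP n) {ε : ℝ} :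
    ‖w - fSum P f‖ ≤ ε ↔ ∀ x' : DualBall X, |x'.1 w - fSum P (applyFam f x')| ≤ ε := by
  rw [norm_le_iff_forall_dualBall]
  simp_rw [map_sub, apply_fSum]
  rfl

theorem hMeasIntegrable_iff {Γ : ℝ → Set X} (hΓ : ∀ t ∈ Icc (0:ℝ) 1, IsCWK X (Γ t)) :
    HMeasIntegrable Γ ↔ ∃ I, IsCWK X I ∧ FamHMeas (suppFam Γ) fun x' => suppFn x'.1 I := by
  refine exists_congr fun I => and_congr_right fun hI => ⟨fun h ε hε => ?_, fun h ε hε => ?_⟩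
  · obtain ⟨δ, h1, h2, h3⟩ := h ε hε
    exact ⟨δ, h1, h2, fun n P hP hf =>
      (hausdorffDist_mSum_le_iff hI hΓ P hε.le).1 (h3 n P hP hf).le⟩
  · obtain ⟨δ, h1, h2, h3⟩ := h (ε / 2) (half_pos hε)
    exact ⟨δ, h1, h2, fun n P hP hf => ((hausdorffDist_mSum_le_iff hI hΓ P (half_pos hε).le).2
      (h3 n P hP hf)).trans_lt (half_lt_self hε)⟩

theorem birkhoffIntegrable_iff {Γ : ℝ → Set X} (hΓ : ∀ t ∈ Icc (0:ℝ) 1, IsCWK X (Γ t)) :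
    BirkhoffIntegrable Γ ↔ ∃ I, IsCWK X I ∧ FamBirkhoff (suppFam Γ) fun x' => suppFn x'.1 I := by
  refine exists_congr fun I => and_congr_right fun hI => ⟨fun h ε hε => ?_, fun h ε hε => ?_⟩
  · obtain ⟨δ, h1, h2, h3⟩ := h ε hε
    exact ⟨δ, h1, h2, fun n P hf =>
      (hausdorffDist_mSum_le_iff hI hΓ P hε.le).1 (h3 n P hf).le⟩
  · obtain ⟨δ, h1, h2, h3⟩ := h (ε / 2) (half_pos hε)
    exact ⟨δ, h1, h2, fun n P hf => ((hausdorffDist_mSum_le_iff hI hΓ P (half_pos hε).le).2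
      (h3 n P hf)).trans_lt (half_lt_self hε)⟩

theorem fHMeasIntegrable_iff {f : ℝ → X} :
    FHMeasIntegrable f ↔ ∃ w, FamHMeas (applyFam f) fun x' => x'.1 w := by
  refine exists_congr fun w => ⟨fun h ε hε => ?_, fun h ε hε => ?_⟩
  · obtain ⟨δ, h1, h2, h3⟩ := h ε hε
    exact ⟨δ, h1, h2, fun n P hP hf => (norm_sub_fSum_le_iff P).1 (h3 n P hP hf).le⟩
  · obtain ⟨δ, h1, h2, h3⟩ := h (ε / 2) (half_pos hε)
    exact ⟨δ, h1, h2, fun n P hP hf =>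
      ((norm_sub_fSum_le_iff P).2 (h3 n P hP hf)).trans_lt (half_lt_self hε)⟩

theorem fBirkhoffIntegrable_of_famBirkhoff {f : ℝ → X} {w : X}
    (h : FamBirkhoff (applyFam f) fun x' => x'.1 w) : FBirkhoffIntegrable f := by
  refine ⟨w, fun ε hε => ?_⟩
  obtain ⟨δ, h1, h2, h3⟩ := h (ε / 2) (half_pos hε)
  exact ⟨δ, h1, h2, fun n P hf =>
    ((norm_sub_fSum_le_iff P).2 (h3 n P hf)).trans_lt (half_lt_self hε)⟩

theorem FMcShaneIntegrable.exists_famMcShane {f : ℝ → X} (h : FMcShaneIntegrable f) :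
    ∃ w, FamMcShane (applyFam f) fun x' => x'.1 w := by
  obtain ⟨w, h⟩ := h
  refine ⟨w, fun ε hε => ?_⟩
  obtain ⟨δ, h1, h2⟩ := h ε hε
  exact ⟨δ, h1, fun n P hf => (norm_sub_fSum_le_iff P).1 (h2 n P hf).le⟩

theorem FBirkhoffIntegrable.fMcShaneIntegrable {f : ℝ → X} (h : FBirkhoffIntegrable f) :
    FMcShaneIntegrable f := by
  obtain ⟨w, h⟩ := h
  refine ⟨w, fun ε hε => ?_⟩
  obtain ⟨δ, h1, -, h2⟩ := h ε hε
  exact ⟨δ, h1, h2⟩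

theorem BirkhoffIntegrable.hMeasIntegrable {Γ : ℝ → Set X} (h : BirkhoffIntegrable Γ) :
    HMeasIntegrable Γ := by
  obtain ⟨I, hI, h⟩ := h
  refine ⟨I, hI, fun ε hε => ?_⟩
  obtain ⟨δ, h1, h2, h3⟩ := h ε hε
  exact ⟨δ, h1, h2, fun n P _ => h3 n P⟩

/-- Every functional is a multiple of an element of the unit ball. -/
theorem exists_eq_smul_dualBall (x' : X →L[ℝ] ℝ) :
    ∃ c : ℝ, 0 < c ∧ ∃ y' : DualBall X, x' = c • y'.1 := by
  refine ⟨‖x'‖ + 1, by positivity, ⟨(‖x'‖ + 1)⁻¹ • x', ?_⟩, ?_⟩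
  · rw [norm_smul, norm_inv, Real.norm_of_nonneg (by positivity), inv_mul_le_iff₀ (by positivity)]
    linarith
  · rw [smul_inv_smul₀ (by positivity)]

theorem ptBdd_suppFam {Γ : ℝ → Set X} (hΓ : ∀ t ∈ Icc (0:ℝ) 1, IsCWK X (Γ t)) :
    PtBdd (suppFam Γ) := by
  intro t ht
  obtain ⟨C, hC⟩ := (hΓ t ht).isBounded.exists_norm_le
  have hC0 : 0 ≤ C := let ⟨x, hx⟩ := (hΓ t ht).1; (norm_nonneg x).trans (hC x hx)
  exact ⟨C, fun x' => (abs_suppFn_le (hΓ t ht).1 hC x'.1).trans (mul_le_of_le_one_right hC0 x'.2)⟩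

theorem ptBdd_applyFam (f : ℝ → X) : PtBdd (applyFam f) := fun t _ =>
  ⟨‖f t‖, norm_le_iff_forall_dualBall.1 le_rfl⟩

/-! ### Selections of Birkhoff integrable multifunctions -/

theorem abs_apply_le_of_mem {A : Set X} (hA : IsCWK X A) {x : X} (hx : x ∈ A) (x' : X →L[ℝ] ℝ) :
    |x' x| ≤ |suppFn x' A| + |suppFn (-x') A| := by
  have h1 := le_suppFn hA.isBounded x' hx
  have h2 := neg_suppFn_neg_le hA.isBounded x' hx
  refine abs_le.2 ⟨?_, ?_⟩
  · linarith [abs_nonneg (suppFn x' A), le_abs_self (suppFn (-x') A)]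
  · linarith [abs_nonneg (suppFn (-x') A), le_abs_self (suppFn x' A)]

theorem BirkhoffIntegrable.fBirkhoffIntegrable_of_selection {Γ : ℝ → Set X}
    (hΓ : ∀ t ∈ Icc (0:ℝ) 1, IsCWK X (Γ t))
    (hsc : ∀ x' : X →L[ℝ] ℝ,
      AEMeasurable (fun t => suppFn x' (Γ t)) (volume.restrict (Icc (0:ℝ) 1)))
    (h : BirkhoffIntegrable Γ) {f : ℝ → X} (hf : Selection Γ f) (hfi : FHMeasIntegrable f) :
    FBirkhoffIntegrable f := by
  obtain ⟨I, hI, h⟩ := (birkhoffIntegrable_iff hΓ).1 h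
  obtain ⟨w, hw⟩ := fHMeasIntegrable_iff.1 hfi
  have hm : ∀ x' : DualBall X, AEMeasurable (suppFam Γ x') (volume.restrict (Icc (0:ℝ) 1)) :=
    fun x' => hsc x'.1
  have hint := h.famMcShane.integrableOn hm
  have hui := h.famMcShane.unifInt hm (ptBdd_suppFam hΓ)
  set ng : DualBall X → DualBall X := fun x' => ⟨-x'.1, by rw [norm_neg]; exact x'.2⟩ with hng
  have hle : ∀ x' : DualBall X, ∀ t ∈ Icc (0:ℝ) 1,
      |applyFam f x' t| ≤ |suppFam Γ x' t| + |suppFam Γ (ng x') t| := fun x' t ht =>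
    abs_apply_le_of_mem (hΓ t ht) (hf t ht) x'.1
  have hfint : ∀ x' : DualBall X, IntegrableOn (applyFam f x') (Icc (0:ℝ) 1) := fun x' => by
    refine Integrable.mono' ((hint x').abs.add (hint (ng x')).abs)
      (hw.aemeasurable x').aestronglyMeasurable ?_
    exact (ae_restrict_iff' measurableSet_Icc).2 (Filter.Eventually.of_forall (hle x'))
  refine fBirkhoffIntegrable_of_famBirkhoff (hw.famBirkhoff hfint ?_ (ptBdd_applyFam f))
  intro ε hε
  obtain ⟨η, hη, hA⟩ := hui (ε / 2) (half_pos hε)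
  refine ⟨η, hη, fun A hA1 hA2 hA3 x' => ?_⟩
  have i1 : ∀ x', IntegrableOn (fun t => |suppFam Γ x' t|) A := fun x' =>
    ((hint x').mono_set hA1).abs
  calc ∫ t in A, |applyFam f x' t| ≤ ∫ t in A, (|suppFam Γ x' t| + |suppFam Γ (ng x') t|) := by
        refine setIntegral_mono_ae_restrict ((hfint x').mono_set hA1).abs ((i1 _).add (i1 _)) ?_
        exact ae_restrict_of_ae_restrict_of_subset hA1
          ((ae_restrict_iff' measurableSet_Icc).2 (Filter.Eventually.of_forall (hle x')))
    _ = (∫ t in A, |suppFam Γ x' t|) + ∫ t in A, |suppFam Γ (ng x') t| :=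
        integral_add (i1 _) (i1 _)
    _ ≤ ε / 2 + ε / 2 := add_le_add (hA A hA1 hA2 hA3 _) (hA A hA1 hA2 hA3 _)
    _ = ε := add_halves ε

/-! ### McShane integrable functions are Pettis integrable -/

theorem FMcShaneIntegrable.fPettisIntegrable [CompleteSpace X] {f : ℝ → X}
    (h : FMcShaneIntegrable f)
    (hm : ∀ x' : DualBall X, AEMeasurable (applyFam f x') (volume.restrict (Icc (0:ℝ) 1))) :
    FPettisIntegrable f := by
  obtain ⟨w, hw⟩ := h.exists_famMcShane
  have hint := hw.integrableOn hm
  refine ⟨fun x' => ?_, fun E hE hEm => ?_⟩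
  · obtain ⟨c, -, y', rfl⟩ := exists_eq_smul_dualBall x'
    exact (hint y').const_mul c
  have happrox : ∀ ε > 0, ∃ v : X, ∀ x' : DualBall X, |x'.1 v - ∫ t in E, applyFam f x' t| ≤ ε := by
    intro ε hε
    obtain ⟨n, P, hP⟩ := hw.exists_stepFn hm hε
    refine ⟨∑ i, volume.real (E ∩ Ioc (P.pt i.castSucc) (P.pt i.succ)) • f (P.tag i), fun x' => ?_⟩
    have e1 : x'.1 (∑ i, volume.real (E ∩ Ioc (P.pt i.castSucc) (P.pt i.succ)) • f (P.tag i)) =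
        ∫ t in E, stepFn P (applyFam f x') t := by
      rw [setIntegral_stepFn P _ hE, map_sum]
      simp [applyFam]
    have i1 := integrableOn_stepFn P (applyFam f x') (subset_refl (Icc (0:ℝ) 1))
    rw [e1, abs_sub_comm, ← integral_sub ((hint x').mono_set hE) (i1.mono_set hE)]
    calc _ ≤ ∫ t in E, |applyFam f x' t - stepFn P (applyFam f x') t| :=
          abs_integral_le_integral_abs
      _ ≤ ∫ t in Icc (0:ℝ) 1, |applyFam f x' t - stepFn P (applyFam f x') t| :=
          setIntegral_mono_set ((hint x').sub i1).abs
            (Filter.Eventually.of_forall fun t => abs_nonneg _) hE.eventuallyLE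
      _ ≤ ε := hP x'
  choose v hv using fun k : ℕ => happrox ((1 / 2 : ℝ) ^ k) (by positivity)
  have hcau : CauchySeq v := by
    refine cauchySeq_of_le_geometric_two (C := 4) fun k => ?_
    rw [dist_eq_norm, norm_le_iff_forall_dualBall]
    intro x'
    have h1 := abs_le.1 (hv k x')
    have h2 := abs_le.1 (hv (k + 1) x')
    have h3 : (1 / 2 : ℝ) ^ (k + 1) = (1 / 2) ^ k / 2 := by ring
    have h4 : (4:ℝ) / 2 / 2 ^ k = 2 * (1 / 2) ^ k := by
      rw [one_div, inv_pow]; ring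
    have h5 : (0:ℝ) < (1 / 2) ^ k := by positivity
    rw [h3] at h2
    rw [h4, map_sub]
    exact abs_le.2 ⟨by linarith, by linarith⟩
  obtain ⟨ν, hν⟩ := cauchySeq_tendsto_of_complete hcau
  refine ⟨ν, fun x' => ?_⟩
  obtain ⟨c, -, y', rfl⟩ := exists_eq_smul_dualBall x'
  have h1 : y'.1 ν = ∫ t in E, y'.1 (f t) := by
    have t1 : Filter.Tendsto (fun k => y'.1 (v k)) Filter.atTop (nhds (y'.1 ν)) :=
      (y'.1.continuous.tendsto ν).comp hν
    refine tendsto_nhds_unique t1 (tendsto_iff_dist_tendsto_zero.2 ?_)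
    exact squeeze_zero (fun _ => dist_nonneg) (fun k => hv k y')
      (tendsto_pow_atTop_nhds_zero_of_lt_one (by norm_num) (by norm_num))
  simp only [smul_apply, smul_eq_mul, integral_const_mul, h1]

/-! ### Pettis integrability from a Pettis integrable selection -/

theorem setIntegral_mono_of_le_Icc {g h : ℝ → ℝ} {E : Set ℝ} (hE : E ⊆ Icc (0:ℝ) 1)
    (hg : IntegrableOn g (Icc (0:ℝ) 1)) (hh : IntegrableOn h (Icc (0:ℝ) 1))
    (hle : ∀ t ∈ Icc (0:ℝ) 1, g t ≤ h t) : ∫ t in E, g t ≤ ∫ t in E, h t :=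
  setIntegral_mono_ae_restrict (hg.mono_set hE) (hh.mono_set hE)
    (ae_restrict_of_ae_restrict_of_subset hE
      ((ae_restrict_iff' measurableSet_Icc).2 (Filter.Eventually.of_forall hle)))

theorem setIntegral_add_setIntegral_sdiff {g : ℝ → ℝ} {E : Set ℝ} (hE : E ⊆ Icc (0:ℝ) 1)
    (hEm : NullMeasurableSet E volume) (hg : IntegrableOn g (Icc (0:ℝ) 1)) :
    (∫ t in E, g t) + ∫ t in Icc (0:ℝ) 1 \ E, g t = ∫ t in Icc (0:ℝ) 1, g t := by
  have := integral_inter_add_sdiff₀ hEm hg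
  rwa [inter_eq_self_of_subset_right hE] at this

theorem pettisIntegrable_of_selection {Γ : ℝ → Set X} (hΓ : ∀ t ∈ Icc (0:ℝ) 1, IsCWK X (Γ t))
    (hsc : ∀ x' : X →L[ℝ] ℝ,
      AEMeasurable (fun t => suppFn x' (Γ t)) (volume.restrict (Icc (0:ℝ) 1)))
    (h : HMeasIntegrable Γ) {f : ℝ → X} (hf : Selection Γ f) (hfi : FPettisIntegrable f) :
    PettisIntegrable Γ := by
  obtain ⟨I, hI, h⟩ := (hMeasIntegrable_iff hΓ).1 h
  have hball : ∀ y' : DualBall X, IntegrableOn (suppFam Γ y') (Icc (0:ℝ) 1) := by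
    intro y'
    obtain ⟨δ, hδ, -, h1⟩ := h 1 one_pos
    obtain ⟨δ', hδ', h2⟩ := exists_gauge_abs_fSum_sub_le (hfi.1 y'.1) one_pos
    have h3 := (integrableOn_of_fSum_le (h := fun t => suppFam Γ y' t - y'.1 (f t))
      (C := suppFn y'.1 I + 1 - (∫ t in Icc (0:ℝ) 1, y'.1 (f t)) + 1)
      ((hsc y'.1).sub (hfi.1 y'.1).aemeasurable)
      (fun t ht => sub_nonneg.2 (le_suppFn (hΓ t ht).isBounded _ (hf t ht))) (hδ.min hδ')
      fun n P hP hPf => by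
        have h4 := abs_le.1 (h1 n P hP (hPf.mono fun t => min_le_left _ _) y')
        have h5 := abs_le.1 (h2 n P (hPf.mono fun t => min_le_right _ _))
        rw [fSum_sub]
        linarith).1
    exact (h3.add (hfi.1 y'.1)).congr_fun (fun t _ => sub_add_cancel _ _) measurableSet_Icc
  have hint : ∀ x' : X →L[ℝ] ℝ, IntegrableOn (fun t => suppFn x' (Γ t)) (Icc (0:ℝ) 1) := by
    intro x'
    obtain ⟨c, hc, y', rfl⟩ := exists_eq_smul_dualBall x'
    simp_rw [suppFn_smul hc.le]
    exact (hball y').const_mul c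
  have hval : ∀ x' : X →L[ℝ] ℝ, suppFn x' I = ∫ t in Icc (0:ℝ) 1, suppFn x' (Γ t) := by
    intro x'
    obtain ⟨c, hc, y', rfl⟩ := exists_eq_smul_dualBall x'
    simp_rw [suppFn_smul hc.le, integral_const_mul]
    rw [h.eq_integral (hball y')]
    rfl
  refine ⟨hint, fun E hE hEm => ?_⟩
  obtain ⟨ν, hν⟩ := hfi.2 (Icc (0:ℝ) 1 \ E) sdiff_subset
    (measurableSet_Icc.nullMeasurableSet.diff hEm)
  refine hI.exists_suppFn_eq (ν := ν) (fun x' y' => ?_) (fun c hc x' => ?_) fun x' => ?_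
  · rw [← integral_add ((hint x').mono_set hE) ((hint y').mono_set hE)]
    exact setIntegral_mono_of_le_Icc hE (hint _) ((hint x').add (hint y')) fun t ht =>
      suppFn_add_le (hΓ t ht).1 (hΓ t ht).isBounded x' y'
  · simp_rw [suppFn_smul hc.le, integral_const_mul]
  · rw [hval, ← setIntegral_add_setIntegral_sdiff hE hEm (hint x'), hν]
    refine add_le_add_right ?_ _
    exact setIntegral_mono_of_le_Icc sdiff_subset (hfi.1 x') (hint x') fun t ht =>
      le_suppFn (hΓ t ht).isBounded x' (hf t ht)

/-! ### Uniform integrability of the support functions of a Pettis integrable multifunction -/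

/-- If all subseries of a series converge weakly, then its terms cannot stay away from zero. -/
theorem exists_norm_lt_of_weak_subseries {w : ℕ → X} {m : (ℕ → Bool) → X}
    (hs : ∀ x' : X →L[ℝ] ℝ, Summable fun j => |x' (w j)|)
    (hm : ∀ (b : ℕ → Bool) (x' : X →L[ℝ] ℝ), x' (m b) = ∑' j, if b j then x' (w j) else 0)
    {ε : ℝ} (hε : 0 < ε) : ∃ j, ‖w j‖ < ε := by
  classical
  by_contra! hw
  have hle : ∀ (b : ℕ → Bool) (x' : X →L[ℝ] ℝ) (j : ℕ),
      ‖if b j then x' (w j) else 0‖ ≤ |x' (w j)| := fun b x' j => by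
    split_ifs
    · exact le_rfl
    · simp
  have hsum : ∀ (b : ℕ → Bool) (x' : X →L[ℝ] ℝ), Summable fun j => if b j then x' (w j) else 0 :=
    fun b x' => (hs x').of_norm_bounded (hle b x')
  have hcont : ∀ x' : X →L[ℝ] ℝ, Continuous fun b => x' (m b) := fun x' => by
    simp_rw [hm]
    refine continuous_tsum (fun j => ?_) (hs x') fun j b => hle b x' j
    exact (continuous_of_discreteTopology (f := fun v : Bool => if v then x' (w j) else 0)).comp
      (continuous_apply j)
  set Y : Submodule ℝ X := (Submodule.span ℝ (range w)).topologicalClosure with hY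
  have hmY : ∀ b, m b ∈ (Y : Set X) := by
    intro b
    by_contra hcon
    obtain ⟨f, u, h1, h2⟩ := geometric_hahn_banach_closed_point Y.convex
      (Submodule.isClosed_topologicalClosure _) hcon
    have hu : 0 < u := by simpa using h1 0 Y.zero_mem
    have hf : ∀ j, f (w j) = 0 := fun j => by
      by_contra hj
      have := h1 ((u / f (w j)) • w j) (Y.smul_mem _
        (Submodule.le_topologicalClosure _ (Submodule.subset_span ⟨j, rfl⟩)))
      rw [map_smul, smul_eq_mul, div_mul_cancel₀ _ hj] at this
      exact lt_irrefl _ this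
    rw [hm] at h2
    simp only [hf, ite_self, tsum_zero] at h2
    linarith
  obtain ⟨c, hc, hYc⟩ := ((countable_range w).isSeparable.span (R := ℝ)).closure
  have : Countable c := hc.to_subtype
  obtain ⟨d, b₀, hb₀⟩ := nonempty_interior_of_iUnion_of_closed
    (f := fun d : c => {b : ℕ → Bool | ‖m b - d‖ ≤ ε / 4}) (fun d => by
      simp_rw [norm_le_iff_forall_dualBall, ofPred_forall, map_sub]
      exact isClosed_iInter fun x' =>
        isClosed_le ((hcont x'.1).sub continuous_const).abs continuous_const)
    (eq_univ_of_forall fun b => by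
      obtain ⟨d, hd, hbd⟩ := Metric.mem_closure_iff.1 (hYc (hmY b)) (ε / 4) (by positivity)
      exact mem_iUnion.2 ⟨⟨d, hd⟩, (dist_eq_norm (m b) d).symm.trans_le hbd.le⟩)
  have hupd : ∀ v : Bool, Filter.Tendsto (fun j : ℕ => Function.update b₀ j v) Filter.atTop
      (nhds b₀) := fun v => by
    refine tendsto_pi_nhds.2 fun i => tendsto_const_nhds.congr' ?_
    filter_upwards [Filter.eventually_gt_atTop i] with j hj
    rw [Function.update_of_ne hj.ne]
  have hnb := mem_interior_iff_mem_nhds.1 hb₀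
  obtain ⟨j, h1, h2⟩ := ((hupd true).eventually hnb |>.and ((hupd false).eventually hnb)).exists
  have hdiff : m (Function.update b₀ j true) - m (Function.update b₀ j false) = w j := by
    by_contra hne
    obtain ⟨f, hf⟩ := geometric_hahn_banach_point_point (E := X) hne
    refine hf.ne ?_
    rw [map_sub, hm, hm, ← (hsum _ f).tsum_sub (hsum _ f), tsum_eq_single j]
    · simp
    · intro i hi
      simp [Function.update_of_ne hi]
  have h3 : ‖w j‖ ≤ ε / 4 + ε / 4 := by
    rw [← hdiff, ← sub_sub_sub_cancel_right _ _ (d : X)]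
    exact (norm_sub_le _ _).trans (add_le_add h1 h2)
  linarith [hw j]

theorem PettisIntegrable.exists_abs_setIntegral_lt {Γ : ℝ → Set X}
    (h : PettisIntegrable Γ) {E : ℕ → Set ℝ}
    (hE : ∀ j, E j ⊆ Icc (0:ℝ) 1) (hEm : ∀ j, NullMeasurableSet (E j) volume)
    (hd : Pairwise (Function.onFun Disjoint E)) (x : ℕ → DualBall X) {ε : ℝ} (hε : 0 < ε) :
    ∃ j, |∫ t in E j, suppFn (x j).1 (Γ t)| < ε := by
  classical
  choose W hW hWE using fun j => h.2 (E j) (hE j) (hEm j)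
  choose w hw hwx using fun j => (hW j).exists_eq_suppFn (x j).1
  have hU : ⋃ j, E j ⊆ Icc (0:ℝ) 1 := iUnion_subset hE
  have hsumm : ∀ x' : X →L[ℝ] ℝ, Summable fun j => |suppFn x' (W j)| := fun x' => by
    have h1 := hasSum_integral_iUnion_ae hEm (fun i j hij => (hd hij).aedisjoint)
      ((h.1 x').mono_set hU).abs
    refine h1.summable.of_nonneg_of_le (fun j => abs_nonneg _) fun j => ?_
    rw [hWE]
    exact abs_integral_le_integral_abs
  have hs : ∀ x' : X →L[ℝ] ℝ, Summable fun j => |x' (w j)| := fun x' =>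
    ((hsumm x').add (hsumm (-x'))).of_nonneg_of_le (fun j => abs_nonneg _)
      fun j => abs_apply_le_of_mem (hW j) (hw j) x'
  have hsum : ∀ (b : ℕ → Bool) (x' : X →L[ℝ] ℝ), Summable fun j => if b j then x' (w j) else 0 :=
    fun b x' => (hs x').of_norm_bounded fun j => by
      split_ifs
      · exact le_rfl
      · simp
  have hrep : ∀ b : ℕ → Bool, ∃ y : X, ∀ x' : X →L[ℝ] ℝ,
      x' y = ∑' j, if b j then x' (w j) else 0 := by
    intro b
    set F : ℕ → Set ℝ := fun j => if b j then E j else ∅ with hF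
    have hFE : ∀ j, F j ⊆ E j := fun j => by
      simp only [hF]
      split_ifs
      · exact le_rfl
      · exact empty_subset _
    have hFm : ∀ j, NullMeasurableSet (F j) volume := fun j => by
      simp only [hF]
      split_ifs
      · exact hEm j
      · exact MeasurableSet.empty.nullMeasurableSet
    have hFU : ⋃ j, F j ⊆ Icc (0:ℝ) 1 := iUnion_subset fun j => (hFE j).trans (hE j)
    obtain ⟨V, hV, hVF⟩ := h.2 _ hFU (NullMeasurableSet.iUnion hFm)
    obtain ⟨y, -, hy⟩ := hV.exists_representing
      { toFun := fun x' => ∑' j, if b j then x' (w j) else 0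
        map_add' := fun x' y' => by
          rw [← (hsum b x').tsum_add (hsum b y')]
          refine tsum_congr fun j => ?_
          split_ifs <;> simp
        map_smul' := fun c x' => by
          rw [RingHom.id_apply, smul_eq_mul, ← tsum_mul_left]
          refine tsum_congr fun j => ?_
          split_ifs <;> simp } fun x' => by
        have h1 := hasSum_integral_iUnion_ae hFm
          (fun i j hij => ((hd hij).mono (hFE i) (hFE j)).aedisjoint) ((h.1 x').mono_set hFU)
        rw [hVF, ← h1.tsum_eq]
        refine (hsum b x').tsum_le_tsum (fun j => ?_) h1.summable
        simp only [hF]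
        split_ifs
        · rw [← hWE]
          exact le_suppFn (hW j).isBounded x' (hw j)
        · simp
    exact ⟨y, hy⟩
  choose m hm using hrep
  obtain ⟨j, hj⟩ := exists_norm_lt_of_weak_subseries hs hm hε
  refine ⟨j, ?_⟩
  rw [← hWE, ← hwx]
  exact (norm_le_iff_forall_dualBall.1 le_rfl (x j)).trans_lt hj

theorem exists_setIntegral_abs_le {h : ℝ → ℝ} (hh : IntegrableOn h (Icc (0:ℝ) 1)) {ε : ℝ}
    (hε : 0 < ε) : ∃ θ > 0, ∀ A ⊆ Icc (0:ℝ) 1, volume A ≤ ENNReal.ofReal θ →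
      ∫ t in A, |h t| ≤ ε := by
  by_contra! hcon
  choose A hA hAv hAi using fun k : ℕ => hcon ((1 / 2 : ℝ) ^ k) (by positivity)
  have h1 : Filter.Tendsto (volume.restrict (Icc (0:ℝ) 1) ∘ A) Filter.atTop (nhds 0) := by
    have h2 : Filter.Tendsto (fun k : ℕ => ENNReal.ofReal ((1 / 2 : ℝ) ^ k)) Filter.atTop
        (nhds 0) := by
      rw [← ENNReal.ofReal_zero]
      exact ENNReal.tendsto_ofReal
        (tendsto_pow_atTop_nhds_zero_of_lt_one (by norm_num) (by norm_num))
    exact tendsto_of_tendsto_of_tendsto_of_le_of_le tendsto_const_nhds h2 (fun _ => zero_le)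
      fun k => (Measure.restrict_apply_le _ _).trans (hAv k)
  have h2 := hh.abs.tendsto_setIntegral_nhds_zero h1
  obtain ⟨k, hk⟩ := (h2.eventually_lt_const hε).exists
  rw [Measure.restrict_restrict_of_subset (hA k)] at hk
  exact (hAi k).not_gt hk

theorem PettisIntegrable.exists_abs_setIntegral_le {Γ : ℝ → Set X} (h : PettisIntegrable Γ)
    {ε : ℝ} (hε : 0 < ε) : ∃ η > 0, ∀ A ⊆ Icc (0:ℝ) 1, NullMeasurableSet A volume →
      volume.real A ≤ η → ∀ x' : DualBall X, |∫ t in A, suppFam Γ x' t| ≤ ε := by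
  by_contra! hcon
  have : Nonempty (DualBall X) := ⟨⟨0, by simp⟩⟩
  choose! A hA hAm hAv x hx using hcon
  choose θ hθ hθi using fun x' : DualBall X => exists_setIntegral_abs_le (h.1 x'.1) (half_pos hε)
  obtain ⟨η, hη1, hηs⟩ : ∃ η : ℕ → ℝ, η 0 = 1 ∧
      ∀ n, η (n + 1) = min (η n / 2) (θ (x (η n)) / 2) :=
    ⟨fun n => Nat.rec 1 (fun _ e => min (e / 2) (θ (x e) / 2)) n, rfl, fun _ => rfl⟩
  have hη0 : ∀ n, 0 < η n := fun n => by
    induction n with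
    | zero => exact hη1 ▸ one_pos
    | succ n ih =>
      rw [hηs]
      exact lt_min (half_pos ih) (half_pos (hθ _))
  have hηpow : ∀ n k, η (n + k) ≤ η n * (1 / 2) ^ k := fun n k => by
    induction k with
    | zero => simp
    | succ k ih =>
      rw [← add_assoc, hηs, pow_succ, ← mul_assoc, mul_one_div]
      exact (min_le_left _ _).trans (by linarith)
  set U : ℕ → Set ℝ := fun j => ⋃ k, A (η (j + 1 + k)) with hU
  have hUm : ∀ j, NullMeasurableSet (U j) volume := fun j =>
    NullMeasurableSet.iUnion fun k => hAm _ (hη0 _)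
  have hUI : ∀ j, U j ⊆ Icc (0:ℝ) 1 := fun j => iUnion_subset fun k => hA _ (hη0 _)
  have hUv : ∀ j, volume (U j) ≤ ENNReal.ofReal (θ (x (η j))) := fun j => by
    have hterm : ∀ k, volume (A (η (j + 1 + k))) ≤
        ENNReal.ofReal (η (j + 1) * (1 / 2) ^ k) := fun k => by
      have hfin : volume (A (η (j + 1 + k))) ≠ ⊤ :=
        ((measure_mono (hA _ (hη0 _))).trans_lt (by simp)).ne
      rw [← ENNReal.ofReal_toReal hfin]
      exact ENNReal.ofReal_le_ofReal ((hAv _ (hη0 _)).trans (hηpow _ _))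
    have hgeo := summable_geometric_two.mul_left (η (j + 1))
    calc volume (U j) ≤ ∑' k, volume (A (η (j + 1 + k))) := measure_iUnion_le _
      _ ≤ ∑' k : ℕ, ENNReal.ofReal (η (j + 1) * (1 / 2) ^ k) := ENNReal.tsum_le_tsum hterm
      _ = ENNReal.ofReal (∑' k : ℕ, η (j + 1) * (1 / 2) ^ k) :=
          (ENNReal.ofReal_tsum_of_nonneg
            (fun k => mul_nonneg (hη0 _).le (by positivity)) hgeo).symm
      _ ≤ ENNReal.ofReal (θ (x (η j))) := by
          rw [tsum_mul_left, tsum_geometric_two]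
          refine ENNReal.ofReal_le_ofReal ?_
          have : η (j + 1) ≤ θ (x (η j)) / 2 := (hηs j).trans_le (min_le_right _ _)
          linarith
  obtain ⟨j, hj⟩ := h.exists_abs_setIntegral_lt (E := fun j => A (η j) \ U j)
    (fun j => sdiff_subset.trans (hA _ (hη0 j))) (fun j => (hAm _ (hη0 j)).diff (hUm j))
    (by
      have key : ∀ i j, i < j → Disjoint (A (η i) \ U i) (A (η j) \ U j) := fun i j hij => by
        refine disjoint_left.2 fun t hi hj => hi.2 (mem_iUnion.2 ⟨j - (i + 1), ?_⟩)
        rw [Nat.add_sub_cancel' hij]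
        exact hj.1
      intro i j hij
      rcases hij.lt_or_gt with hij | hij
      · exact key i j hij
      · exact (key j i hij).symm) (fun j => x (η j)) (half_pos hε)
  have hi := (h.1 (x (η j)).1).mono_set (hA _ (hη0 j))
  have h1 := integral_inter_add_sdiff₀ (hUm j) hi
  have h2 : |∫ t in A (η j) ∩ U j, suppFn (x (η j)).1 (Γ t)| ≤ ε / 2 :=
    abs_integral_le_integral_abs.trans (hθi (x (η j)) _ (inter_subset_left.trans (hA _ (hη0 j)))
      ((measure_mono inter_subset_right).trans (hUv j)))
  have h3 := hx _ (hη0 j)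
  unfold suppFam at h3
  rw [← h1] at h3
  have h4 := h3.trans_le (abs_add_le _ _)
  linarith

theorem PettisIntegrable.unifInt {Γ : ℝ → Set X} (h : PettisIntegrable Γ) :
    UnifInt (suppFam Γ) := by
  intro ε hε
  obtain ⟨η, hη, hA⟩ := h.exists_abs_setIntegral_le (half_pos hε)
  refine ⟨η, hη, fun A hAI hAm hAv x' => ?_⟩
  have hi : IntegrableOn (suppFam Γ x') (Icc (0:ℝ) 1) := h.1 x'.1
  set g := hi.aemeasurable.mk _ with hg
  have hgm : Measurable g := hi.aemeasurable.measurable_mk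
  have hae : ∀ᵐ t ∂volume, t ∈ Icc (0:ℝ) 1 → suppFam Γ x' t = g t :=
    (ae_restrict_iff' measurableSet_Icc).1 hi.aemeasurable.ae_eq_mk
  have hB : MeasurableSet {t | 0 ≤ g t} := measurableSet_le measurable_const hgm
  have hv : ∀ C, volume.real (A ∩ C) ≤ η ∧ volume.real (A \ C) ≤ η := fun C =>
    have hfin : volume A ≠ ⊤ := ((measure_mono hAI).trans_lt (by simp)).ne
    ⟨(measureReal_mono inter_subset_left hfin).trans hAv,
      (measureReal_mono sdiff_subset hfin).trans hAv⟩
  rw [← integral_inter_add_sdiff hB (hi.mono_set hAI).abs]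
  have e1 : ∫ t in A ∩ {t | 0 ≤ g t}, |suppFam Γ x' t| =
      ∫ t in A ∩ {t | 0 ≤ g t}, suppFam Γ x' t := by
    refine setIntegral_congr_ae₀ (hAm.inter hB.nullMeasurableSet) ?_
    filter_upwards [hae] with t ht h1
    rw [abs_of_nonneg]
    rw [ht (hAI h1.1)]
    exact h1.2
  have e2 : ∫ t in A \ {t | 0 ≤ g t}, |suppFam Γ x' t| =
      -∫ t in A \ {t | 0 ≤ g t}, suppFam Γ x' t := by
    rw [← integral_neg]
    refine setIntegral_congr_ae₀ (hAm.diff hB.nullMeasurableSet) ?_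
    filter_upwards [hae] with t ht h1
    rw [abs_of_nonpos]
    rw [ht (hAI h1.1)]
    exact (not_le.1 h1.2).le
  rw [e1, e2]
  have h1 := abs_le.1 (hA _ (inter_subset_left.trans hAI) (hAm.inter hB.nullMeasurableSet)
    (hv _).1 x')
  have h2 := abs_le.1 (hA _ (sdiff_subset.trans hAI) (hAm.diff hB.nullMeasurableSet) (hv _).2 x')
  linarith

theorem PettisIntegrable.birkhoffIntegrable {Γ : ℝ → Set X}
    (hΓ : ∀ t ∈ Icc (0:ℝ) 1, IsCWK X (Γ t)) (h : PettisIntegrable Γ) (h' : HMeasIntegrable Γ) :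
    BirkhoffIntegrable Γ := by
  obtain ⟨I, hI, hf⟩ := (hMeasIntegrable_iff hΓ).1 h'
  exact (birkhoffIntegrable_iff hΓ).2
    ⟨I, hI, hf.famBirkhoff (fun x' => h.1 x'.1) h.unifInt (ptBdd_suppFam hΓ)⟩

/-! ### Strongly exposed points of convex weakly compact sets -/

theorem suppFn_le_add {A : Set X} (hne : A.Nonempty) {M : ℝ} (hM : ∀ x ∈ A, ‖x‖ ≤ M)
    (x' y' : X →L[ℝ] ℝ) : suppFn x' A ≤ suppFn y' A + M * ‖x' - y'‖ := by
  have h1 := suppFn_add_le hne (isBounded_iff_forall_norm_le.2 ⟨M, hM⟩) y' (x' - y')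
  rw [add_sub_cancel] at h1
  linarith [(abs_le.1 (abs_suppFn_le hne hM (x' - y'))).2]

theorem apply_le_add_of_norm_le {x : X} {M : ℝ} (hM : ‖x‖ ≤ M) (x' y' : X →L[ℝ] ℝ) :
    x' x ≤ y' x + M * ‖x' - y'‖ := by
  have h1 := (le_abs_self _).trans ((x' - y').le_opNorm x)
  rw [sub_apply] at h1
  nlinarith [norm_nonneg (x' - y')]

/-- The functionals which determine a slice of diameter at most `ε`. -/
def smallSlice (K : Set X) (ε : ℝ) : Set (X →L[ℝ] ℝ) :=
  {x' | ∃ α > 0, ∀ x ∈ K, ∀ y ∈ K, suppFn x' K - α < x' x → suppFn x' K - α < x' y → ‖x - y‖ ≤ ε}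

theorem isOpen_smallSlice {K : Set X} (hK : IsCWK X K) (ε : ℝ) : IsOpen (smallSlice K ε) := by
  obtain ⟨M, hM0, hM⟩ := hK.isBounded.exists_pos_norm_le
  refine Metric.isOpen_iff.2 fun x' ⟨α, hα, h⟩ => ⟨α / (4 * M), by positivity, fun y' hy' => ?_⟩
  rw [mem_ball, dist_eq_norm, lt_div_iff₀ (by positivity)] at hy'
  have h1 := suppFn_le_add hK.1 hM x' y'
  rw [norm_sub_rev] at h1
  have key : ∀ x ∈ K, suppFn y' K - α / 4 < y' x → suppFn x' K - α < x' x := fun x hx hxs => by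
    have := apply_le_add_of_norm_le (hM x hx) y' x'
    linarith
  exact ⟨α / 4, by positivity, fun x hx y hy hxs hys => h x hx y hy (key x hx hxs) (key y hy hys)⟩

theorem exists_avoid_of_notMem_smallSlice {K : Set X} (hK : IsCWK X K) {ε : ℝ} (hε : 0 < ε)
    {z : X →L[ℝ] ℝ} (hz : z ∉ smallSlice K (4 * ε)) {r : ℝ} (hr : 0 < r) (c : X) :
    ∃ z' ∈ ball z r, ∃ α > 0, ∀ y ∈ K, ‖y - c‖ ≤ ε → z' y ≤ suppFn z' K - α := by
  by_contra! hcon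
  refine hz ⟨r * ε / 4, by positivity, ?_⟩
  have key : ∀ x ∈ K, suppFn z K - r * ε / 4 < z x → ‖x - c‖ ≤ 2 * ε := by
    intro x hx hxs
    obtain ⟨h, hh1, hh2⟩ := exists_dual_vector'' ℝ (x - c)
    have hh2 : h (x - c) = ‖x - c‖ := hh2
    have hn : ‖(r / 2) • h‖ ≤ r / 2 := by
      rw [norm_smul, Real.norm_of_nonneg (by positivity)]
      exact mul_le_of_le_one_right (by positivity) hh1
    obtain ⟨k, hk, hkc, hks⟩ := hcon (z + (r / 2) • h)
      (by rw [mem_ball, dist_eq_norm, add_sub_cancel_left]; linarith) (r * ε / 4) (by positivity)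
    have h1 := le_suppFn hK.isBounded (z + (r / 2) • h) hx
    have h2 := le_suppFn hK.isBounded z hk
    have h3 : h (k - c) ≤ ε := (le_abs_self _).trans
      ((norm_le_iff_forall_dualBall.1 le_rfl (⟨h, hh1⟩ : DualBall X)).trans hkc)
    simp only [add_apply, smul_apply, smul_eq_mul] at h1 hks
    rw [map_sub] at h3 hh2
    rw [← hh2]
    have h4 : r / 2 * (h x - h c) ≤ r / 2 * (2 * ε) := by nlinarith
    exact le_of_mul_le_mul_left h4 (by positivity)
  intro x hx y hy hxs hys
  rw [← sub_sub_sub_cancel_right x y c]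
  exact (norm_sub_le _ _).trans (by linarith [key x hx hxs, key y hy hys])

theorem isOpen_avoid {K : Set X} (hK : IsCWK X K) (T : Set X) :
    IsOpen {z : X →L[ℝ] ℝ | ∃ α > 0, ∀ y ∈ K ∩ T, z y ≤ suppFn z K - α} := by
  obtain ⟨M, hM0, hM⟩ := hK.isBounded.exists_pos_norm_le
  refine Metric.isOpen_iff.2 fun x' ⟨α, hα, h⟩ => ⟨α / (4 * M), by positivity, fun y' hy' => ?_⟩
  rw [mem_ball, dist_eq_norm, lt_div_iff₀ (by positivity)] at hy'
  refine ⟨α / 2, by positivity, fun y hy => ?_⟩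
  have h1 := suppFn_le_add hK.1 hM x' y'
  rw [norm_sub_rev] at h1
  have h2 := apply_le_add_of_norm_le (hM y hy.1) y' x'
  linarith [h y hy]

theorem exists_ball_avoid {K : Set X} (hK : IsCWK X K) {ε : ℝ} (hε : 0 < ε)
    (C : Finset X) : ∀ {z : X →L[ℝ] ℝ} {r : ℝ}, 0 < r →
      Disjoint (closedBall z r) (smallSlice K (4 * ε)) →
      ∃ z₁, ∃ r₁ > 0, closedBall z₁ r₁ ⊆ closedBall z r ∧
        ∀ z' ∈ closedBall z₁ r₁, ∀ c ∈ C, ∀ y ∈ K, ‖y - c‖ ≤ ε → z' y < suppFn z' K := by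
  classical
  induction C using Finset.induction_on with
  | empty => exact fun {z r} hr _ => ⟨z, r, hr, subset_rfl, by simp⟩
  | insert c C _ ih =>
    intro z r hr hd
    obtain ⟨z₁, r₁, hr₁, hsub, h⟩ := ih hr hd
    obtain ⟨z₂, hz₂, hα⟩ := exists_avoid_of_notMem_smallSlice hK hε
      (disjoint_left.1 hd (hsub (mem_closedBall_self hr₁.le))) hr₁ c
    obtain ⟨r₂, hr₂, hsub₂⟩ := nhds_basis_closedBall.mem_iff.1
      ((isOpen_ball.inter (isOpen_avoid hK {y | ‖y - c‖ ≤ ε})).mem_nhds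
        ⟨hz₂, hα.imp fun α ⟨h1, h2⟩ => ⟨h1, fun y hy => h2 y hy.1 hy.2⟩⟩)
    have hsub₃ : closedBall z₂ r₂ ⊆ closedBall z₁ r₁ :=
      fun x hx => ball_subset_closedBall (hsub₂ hx).1
    refine ⟨z₂, r₂, hr₂, hsub₃.trans hsub, fun z' hz' c' hc' y hy hyc => ?_⟩
    rcases Finset.mem_insert.1 hc' with rfl | hc'
    · obtain ⟨α, hα0, hα⟩ := (hsub₂ hz').2
      linarith [hα y ⟨hy, hyc⟩]
    · exact h z' (hsub₃ hz') c' hc' y hy hyc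

theorem exists_ball_avoid_convexHull {K : Set X} (hK : IsCWK X K) {ε : ℝ} (hε : 0 < ε)
    (F : Finset X) {z : X →L[ℝ] ℝ} {r : ℝ} (hr : 0 < r)
    (hd : Disjoint (closedBall z r) (smallSlice K (4 * ε))) :
    ∃ z₁, ∃ r₁ > 0, r₁ ≤ r / 2 ∧ closedBall z₁ r₁ ⊆ closedBall z r ∧
      ∀ z' ∈ closedBall z₁ r₁, ∀ q ∈ convexHull ℝ (F : Set X), ∀ y ∈ K, ‖y - q‖ ≤ ε / 2 →
        z' y < suppFn z' K := by
  obtain ⟨C, -, hCf, hC⟩ := finite_cover_balls_of_compact (F.finite_toSet.isCompact_convexHull ℝ)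
    (half_pos hε)
  obtain ⟨z₁, r₁, hr₁, hsub, h⟩ := exists_ball_avoid hK hε hCf.toFinset hr hd
  refine ⟨z₁, min r₁ (r / 2), lt_min hr₁ (half_pos hr), min_le_right _ _,
    (closedBall_subset_closedBall (min_le_left _ _)).trans hsub, fun z' hz' q hq y hy hyq => ?_⟩
  obtain ⟨c, hc, hqc⟩ := mem_iUnion₂.1 (hC hq)
  refine h z' (closedBall_subset_closedBall (min_le_left _ _) hz') c (hCf.mem_toFinset.2 hc) y hy ?_
  rw [mem_ball, dist_eq_norm] at hqc
  rw [← sub_add_sub_cancel y q c]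
  exact (norm_add_le _ _).trans (by linarith)

theorem IsCWK.isClosed {A : Set X} (hA : IsCWK X A) : IsClosed A := by
  have : A = ⋂ x' : X →L[ℝ] ℝ, {x | x' x ≤ suppFn x' A} := by
    ext x
    rw [mem_iInter]
    exact ⟨fun hx x' => le_suppFn hA.isBounded x' hx, hA.mem_of_forall_le⟩
  rw [this]
  exact isClosed_iInter fun x' => isClosed_le x'.continuous continuous_const

theorem IsCWK.of_isClosed_subset {A B : Set X} (hA : IsCWK X A) (hB : B.Nonempty)
    (hBc : Convex ℝ B) (hBcl : IsClosed B) (hBA : B ⊆ A) : IsCWK X B := by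
  refine ⟨hB, hBc, hA.2.2.of_isClosed_subset ?_ (image_mono hBA)⟩
  have := hBc.toWeakSpace_closure ℝ
  rw [hBcl.closure_eq] at this
  rw [this]
  exact isClosed_closure

theorem dense_smallSlice {K : Set X} (hK : IsCWK X K) {ε : ℝ} (hε : 0 < ε) :
    Dense (smallSlice K (4 * ε)) := by
  classical
  by_contra hcon
  obtain ⟨u, hu⟩ := not_forall.1 hcon
  obtain ⟨R, hR, hdR⟩ : ∃ R > 0, Disjoint (closedBall u R) (smallSlice K (4 * ε)) := by
    obtain ⟨R, hR, h⟩ := nhds_basis_closedBall.mem_iff.1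
      (isClosed_closure.isOpen_compl.mem_nhds hu)
    exact ⟨R, hR, disjoint_left.2 fun x hx hx' => h hx (subset_closure hx')⟩
  obtain ⟨M, hM0, hM⟩ := hK.isBounded.exists_pos_norm_le
  choose m hmK hm using hK.exists_eq_suppFn
  choose! Z ρ hρ0 hρ hsub hav using fun (F : Finset X) (z : X →L[ℝ] ℝ) (r : ℝ)
    (h : 0 < r ∧ Disjoint (closedBall z r) (smallSlice K (4 * ε))) =>
    exists_ball_avoid_convexHull hK hε F h.1 h.2
  obtain ⟨z, r, F, hz0, hr0, hF0, hzs, hrs, hFs⟩ :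
      ∃ (z : ℕ → X →L[ℝ] ℝ) (r : ℕ → ℝ) (F : ℕ → Finset X),
      z 0 = u ∧ r 0 = R ∧ F 0 = ∅ ∧ (∀ n, z (n + 1) = Z (F (n + 1)) (z n) (r n)) ∧
      (∀ n, r (n + 1) = ρ (F (n + 1)) (z n) (r n)) ∧ ∀ n, F (n + 1) = insert (m (z n)) (F n) := by
    let s : ℕ → (X →L[ℝ] ℝ) × ℝ × Finset X := fun n => Nat.rec (u, R, ∅) (fun _ a =>
      (Z (insert (m a.1) a.2.2) a.1 a.2.1, ρ (insert (m a.1) a.2.2) a.1 a.2.1,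
        insert (m a.1) a.2.2)) n
    exact ⟨fun n => (s n).1, fun n => (s n).2.1, fun n => (s n).2.2, rfl, rfl, rfl, fun _ => rfl,
      fun _ => rfl, fun _ => rfl⟩
  have hgood : ∀ n, 0 < r n ∧ Disjoint (closedBall (z n) (r n)) (smallSlice K (4 * ε)) := by
    intro n
    induction n with
    | zero => rw [hz0, hr0]; exact ⟨hR, hdR⟩
    | succ n ih =>
      rw [hzs, hrs]
      exact ⟨hρ0 _ _ _ ih, ih.2.mono_left (hsub _ _ _ ih)⟩
  have hnest : ∀ n, closedBall (z (n + 1)) (r (n + 1)) ⊆ closedBall (z n) (r n) := fun n => by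
    rw [hzs, hrs]
    exact hsub _ _ _ (hgood n)
  have hanti : Antitone fun n => closedBall (z n) (r n) := antitone_nat_of_succ_le hnest
  have hrpow : ∀ n, r n ≤ R * (1 / 2) ^ n := fun n => by
    induction n with
    | zero => simp [hr0]
    | succ n ih =>
      rw [hrs, pow_succ, ← mul_assoc, mul_one_div]
      exact (hρ _ _ _ (hgood n)).trans (by linarith)
  have hRlim : Filter.Tendsto (fun n : ℕ => R * (1 / 2) ^ n) Filter.atTop (nhds 0) := by
    simpa using (tendsto_pow_atTop_nhds_zero_of_lt_one (r := (1 / 2 : ℝ)) (by norm_num)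
      (by norm_num)).const_mul R
  have hmem : ∀ k n, k ≤ n → z n ∈ closedBall (z k) (r k) := fun k n hkn =>
    hanti hkn (mem_closedBall_self (hgood n).1.le)
  have hcau : CauchySeq z := by
    refine cauchySeq_of_le_tendsto_0' (fun n : ℕ => R * (1 / 2) ^ n) (fun k n hkn => ?_) hRlim
    rw [dist_comm]
    exact (hmem k n hkn).trans (hrpow k)
  obtain ⟨x', hx'⟩ := cauchySeq_tendsto_of_complete hcau
  have hx'm : ∀ k, x' ∈ closedBall (z k) (r k) := fun k =>
    isClosed_closedBall.mem_of_tendsto hx' (Filter.eventually_atTop.2 ⟨k, hmem k⟩)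
  have hFmono : Monotone F := monotone_nat_of_le_succ fun n => by
    rw [hFs]
    exact Finset.subset_insert _ _
  set Q : Set X := closure (⋃ n, convexHull ℝ (F (n + 1) : Set X)) with hQ
  have hFK : ∀ n, (F n : Set X) ⊆ K := fun n => by
    induction n with
    | zero => simp [hF0]
    | succ n ih =>
      rw [hFs, Finset.coe_insert]
      exact insert_subset (hmK _) ih
  have hQc : Convex ℝ (⋃ n, convexHull ℝ (F (n + 1) : Set X)) := by
    refine Directed.convex_iUnion (Monotone.directed_le fun i j hij => ?_)
      fun _ => convex_convexHull ℝ _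
    exact convexHull_mono (Finset.coe_subset.2 (hFmono (Nat.succ_le_succ hij)))
  have hmQ : ∀ n, m (z n) ∈ ⋃ n, convexHull ℝ (F (n + 1) : Set X) := fun n =>
    mem_iUnion.2 ⟨n, subset_convexHull ℝ _ (by rw [hFs]; simp)⟩
  have hQK : Q ⊆ K := closure_minimal
    (iUnion_subset fun n => convexHull_min (hFK _) hK.2.1) hK.isClosed
  have hQcwk : IsCWK X Q := hK.of_isClosed_subset ⟨_, subset_closure (hmQ 0)⟩ hQc.closure
    isClosed_closure hQK
  obtain ⟨y, hyQ, hy⟩ := hQcwk.exists_eq_suppFn x'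
  have hmax : suppFn x' K ≤ x' y := by
    refine le_of_forall_pos_le_add fun η hη => ?_
    obtain ⟨n, hn⟩ := (hRlim.eventually_lt_const (show 0 < η / (2 * M) by positivity)).exists
    have h1 := hx'm n
    rw [mem_closedBall, dist_eq_norm] at h1
    have h2 := suppFn_le_add hK.1 hM x' (z n)
    have h3 := apply_le_add_of_norm_le (hM _ (hmK (z n))) (z n) x'
    rw [norm_sub_rev, hm] at h3
    have h4 := le_suppFn hQcwk.isBounded x' (subset_closure (hmQ n))
    have h5 : M * ‖x' - z n‖ ≤ M * (η / (2 * M)) :=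
      mul_le_mul_of_nonneg_left (h1.trans ((hrpow n).trans hn.le)) hM0.le
    have h6 : M * (η / (2 * M)) = η / 2 := by field_simp
    linarith
  obtain ⟨q, hq, hyq⟩ := Metric.mem_closure_iff.1 hyQ (ε / 2) (half_pos hε)
  obtain ⟨n, hqn⟩ := mem_iUnion.1 hq
  have hx'n := hx'm (n + 1)
  rw [hzs, hrs] at hx'n
  rw [dist_eq_norm] at hyq
  exact (hav _ _ _ (hgood n) x' hx'n q hqn y (hQK hyQ) hyq.le).not_ge hmax

/-- Every convex weakly compact set has a strongly exposed point. -/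
theorem IsCWK.exists_stronglyExposed {K : Set X} (hK : IsCWK X K) :
    ∃ x' : X →L[ℝ] ℝ, ∃ x ∈ K, x' x = suppFn x' K ∧
      ∀ ε > 0, ∃ α > 0, ∀ y ∈ K, suppFn x' K - α < x' y → ‖y - x‖ ≤ ε := by
  obtain ⟨x', hx'⟩ := (dense_iInter_of_isOpen
    (fun k : ℕ => isOpen_smallSlice hK (4 * (1 / ((k : ℝ) + 1))))
    fun k => dense_smallSlice hK Nat.one_div_pos_of_nat).nonempty
  obtain ⟨x, hx, hxs⟩ := hK.exists_eq_suppFn x'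
  refine ⟨x', x, hx, hxs, fun ε hε => ?_⟩
  obtain ⟨k, hk⟩ := exists_nat_one_div_lt (show 0 < ε / 4 by positivity)
  obtain ⟨α, hα, h⟩ := mem_iInter.1 hx' k
  exact ⟨α, hα, fun y hy hys => (h y hy x hx hys (by linarith)).trans (by linarith)⟩

theorem HMeasIntegrable.exists_selection {Γ : ℝ → Set X} (hΓ : ∀ t ∈ Icc (0:ℝ) 1, IsCWK X (Γ t))
    (h : HMeasIntegrable Γ) : ∃ f : ℝ → X, Selection Γ f ∧ FHMeasIntegrable f := by
  obtain ⟨I, hI, h⟩ := h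
  obtain ⟨x', x, hx, hxs, hexp⟩ := hI.exists_stronglyExposed
  choose! f hf hfs using fun t ht => (hΓ t ht).exists_eq_suppFn x'
  refine ⟨f, hf, x, fun ε hε => ?_⟩
  obtain ⟨α, hα, hαε⟩ := hexp (ε / 4) (by positivity)
  obtain ⟨δ, hδ, hδm, hδh⟩ := h (min (ε / 4) (α / (2 * (‖x'‖ + 1)))) (by positivity)
  refine ⟨δ, hδ, hδm, fun n P hP hPf => ?_⟩
  have hd := hδh n P hP hPf
  obtain ⟨hne, hbd, -, hsupp⟩ := mSum_spec P hΓ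
  have hfin := hausdorffEDist_ne_top_of_nonempty_of_bounded hI.1 hne hI.isBounded hbd
  have hs : x' (fSum P f) = suppFn x' (mSum P Γ) := by
    rw [hsupp, apply_fSum]
    exact Finset.sum_congr rfl fun i _ =>
      congrArg (P.len i • ·) (hfs _ (P.tagMem i))
  obtain ⟨s, hsm, hxs'⟩ := exists_dist_lt_of_hausdorffDist_lt hx hd hfin
  obtain ⟨y, hyI, hys⟩ := exists_dist_lt_of_hausdorffDist_lt' (fSum_mem_mSum P hf) hd hfin
  obtain ⟨hyε, hyα⟩ := lt_min_iff.1 hys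
  have hxα := (lt_min_iff.1 hxs').2
  rw [dist_eq_norm] at hyε hyα hxα
  have hmul : ∀ z : X, ‖z‖ < α / (2 * (‖x'‖ + 1)) → x' z < α / 2 := fun z hz => by
    rw [lt_div_iff₀ (by positivity)] at hz
    have := (le_abs_self _).trans (x'.le_opNorm z)
    nlinarith [norm_nonneg z, norm_nonneg x']
  rw [norm_sub_rev] at hyα
  have h1 := hmul _ hyα
  have h2 := hmul _ hxα
  have h3 := le_suppFn hbd x' hsm
  rw [map_sub] at h1 h2
  have h4 := hαε y hyI (by linarith)
  rw [norm_sub_rev] at h4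
  rw [← sub_add_sub_cancel x y]
  exact (norm_add_le _ _).trans_lt (by linarith)

/-- Theorem `t3a` of the paper. For a scalarly measurable multifunction
`Γ : [0,1] → cwk(X)` the following are equivalent: (i) `Γ` is Birkhoff integrable;
(ii) `Γ` is `ℋ`-integrable and every `ℋ`-integrable selection is Birkhoff integrable;
(iii) `Γ` is `ℋ`-integrable and every `ℋ`-integrable selection is McShane integrable;
(iv) `Γ` is `ℋ`-integrable and every `ℋ`-integrable selection is Pettis integrable;
(v) `Γ` is `ℋ`-integrable and has a Pettis integrable selection;
(vi) `Γ` is Pettis and `ℋ`-integrable. -/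
theorem birkhoff_tfae
    {X : Type*} [NormedAddCommGroup X] [NormedSpace ℝ X] [CompleteSpace X]
    (Γ : ℝ → Set X) (hΓ : ∀ t ∈ Icc (0:ℝ) 1, IsCWK X (Γ t))
    (hsc : ∀ x' : X →L[ℝ] ℝ,
      AEMeasurable (fun t => suppFn x' (Γ t)) (volume.restrict (Icc (0:ℝ) 1))) :
    List.TFAE [
      BirkhoffIntegrable Γ,
      HMeasIntegrable Γ ∧
        ∀ f : ℝ → X, Selection Γ f → FHMeasIntegrable f → FBirkhoffIntegrable f,
      HMeasIntegrable Γ ∧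
        ∀ f : ℝ → X, Selection Γ f → FHMeasIntegrable f → FMcShaneIntegrable f,
      HMeasIntegrable Γ ∧
        ∀ f : ℝ → X, Selection Γ f → FHMeasIntegrable f → FPettisIntegrable f,
      HMeasIntegrable Γ ∧ ∃ f : ℝ → X, Selection Γ f ∧ FPettisIntegrable f,
      PettisIntegrable Γ ∧ HMeasIntegrable Γ
    ] := by
  tfae_have 1 → 2 := fun h =>
    ⟨h.hMeasIntegrable, fun f hf hfi => h.fBirkhoffIntegrable_of_selection hΓ hsc hf hfi⟩
  tfae_have 2 → 3 := fun ⟨h, hsel⟩ =>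
    ⟨h, fun f hf hfi => (hsel f hf hfi).fMcShaneIntegrable⟩
  tfae_have 3 → 4 := fun ⟨h, hsel⟩ => ⟨h, fun f hf hfi => by
    obtain ⟨w, hw⟩ := fHMeasIntegrable_iff.1 hfi
    exact (hsel f hf hfi).fPettisIntegrable hw.aemeasurable⟩
  tfae_have 4 → 5 := fun ⟨h, hsel⟩ => by
    obtain ⟨f, hf, hfi⟩ := h.exists_selection hΓ
    exact ⟨h, f, hf, hsel f hf hfi⟩
  tfae_have 5 → 6 := fun ⟨h, f, hf, hfi⟩ => ⟨pettisIntegrable_of_selection hΓ hsc h hf hfi, h⟩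
  tfae_have 6 → 1 := fun ⟨h, h'⟩ => h.birkhoffIntegrable hΓ h'
  tfae_finish

end GaugePaper
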